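/- arXiv:1212.0649 — 2 statements merged into one kernel-verified Lean document; each statement's English description precedes it below -/
import Mathlib

section
/- The optimal 8-point arrangement on the square flat torus is unique up to isometry: if p, q : Fin 8 → ℝ × ℝ are two configurations such that for all i ≠ j and all integers m, n one has ‖p i − p j + (m, n)‖ ≥ 1/(1 + √3) and ‖q i − q j + (m, n)‖ ≥ 1/(1 + √3), then there exist a 2×2 orthogonal matrix Q with integer entries, a vector t ∈ ℝ², and a permutation σ of Fin 8 such that p i − (Q·(q (σ i)) + t) ∈ ℤ² for every i. -/
/-- The Euclidean norm on `ℝ × ℝ`. -/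
noncomputable def e2norm (v : ℝ × ℝ) : ℝ := Real.sqrt (v.1 ^ 2 + v.2 ^ 2)

/-- Application of a `2 × 2` real matrix to a vector of `ℝ × ℝ`. -/
noncomputable def mulVec2 (Q : Matrix (Fin 2) (Fin 2) ℝ) (v : ℝ × ℝ) : ℝ × ℝ :=
  (Q 0 0 * v.1 + Q 0 1 * v.2, Q 1 0 * v.1 + Q 1 1 * v.2)

namespace TorusPacking

/-! ### Sectors and linear forms -/

/-- A closed sector, spanned counterclockwise from direction `(a₁, a₂)` to direction `(b₁, b₂)`
(in thousandths), for the difference vector from point `i` to point `j` shifted by `(m, n)`. -/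
structure Sector where
  i : ℕ
  j : ℕ
  m : ℤ
  n : ℤ
  a₁ : ℤ
  a₂ : ℤ
  b₁ : ℤ
  b₂ : ℤ

/-- A binary subdivision of the configuration space into sectors, with certificates at the
leaves. -/
inductive Cert where
  /-- The constraints numbered by the digits of `c`, with the given weights, are contradictory. -/
  | leaf (c : ℕ)
  /-- All contact vectors of the optimal arrangement are confined to narrow sectors. -/
  | near (lab : List (ℕ × ℤ × ℤ)) (pos : List ℕ)
  /-- Cut the sector at position `k` along the direction `(c₁, c₂)`. -/
  | split (k : ℕ) (c₁ c₂ : ℤ) (l r : Cert)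

/-- Add `c` to the `k`-th coefficient of a linear form. -/
def bump : ℕ → ℤ → List ℤ → List ℤ
  | 0, c, [] => [c]
  | 0, c, a :: l => (a + c) :: l
  | k + 1, c, [] => 0 :: bump k c []
  | k + 1, c, a :: l => a :: bump k c l

/-- Value of a linear form with coefficient list `l` at the point `z`, starting at variable `k`. -/
noncomputable def ev (z : ℕ → ℝ) : ℕ → List ℤ → ℝ
  | _, [] => 0
  | k, a :: l => a * z k + ev z (k + 1) l

theorem ev_bump (z : ℕ → ℝ) (c : ℤ) (k : ℕ) (l : List ℤ) (s : ℕ) :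
    ev z s (bump k c l) = ev z s l + c * z (s + k) := by
  induction k generalizing l s with
  | zero => cases l <;> simp [bump, ev]; ring
  | succ k ih =>
    cases l with
    | nil =>
      simp only [bump, ev, ih]
      push_cast
      ring_nf
    | cons a l => simp [bump, ev, ih]; ring_nf

/-- The variable list `1, x₀, y₀, x₁, y₁, …`. -/
def vars (x y : ℕ → ℝ) (k : ℕ) : ℝ :=
  if k = 0 then 1 else if k % 2 = 1 then x (k / 2) else y (k / 2 - 1)

theorem vars_zero (x y : ℕ → ℝ) : vars x y 0 = 1 := by simp [vars]

theorem vars_x (x y : ℕ → ℝ) (i : ℕ) : vars x y (2 * i + 1) = x i := by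
  have h2 : (2 * i + 1) / 2 = i := by omega
  simp [vars, h2]

theorem vars_y (x y : ℕ → ℝ) (i : ℕ) : vars x y (2 * i + 2) = y i := by
  simp [vars]

/-- Add the form `α v₁ + β v₂ + γ`, where `v` is the difference vector of the sector `e`. -/
def addForm (e : Sector) (α β γ : ℤ) (l : List ℤ) : List ℤ :=
  bump 0 (γ - α * e.m - β * e.n) <| bump (2 * e.j + 1) α <| bump (2 * e.i + 1) (-α) <|
    bump (2 * e.j + 2) β <| bump (2 * e.i + 2) (-β) l

/-- First component of the difference vector of a sector. -/
def Sector.v₁ (e : Sector) (x : ℕ → ℝ) : ℝ := x e.j - x e.i - e.m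

/-- Second component of the difference vector of a sector. -/
def Sector.v₂ (e : Sector) (y : ℕ → ℝ) : ℝ := y e.j - y e.i - e.n

theorem ev_addForm (x y : ℕ → ℝ) (e : Sector) (α β γ : ℤ) (l : List ℤ) :
    ev (vars x y) 0 (addForm e α β γ l) =
      ev (vars x y) 0 l + (α * e.v₁ x + β * e.v₂ y + γ) := by
  simp only [addForm, ev_bump, zero_add, vars_zero, vars_x, vars_y, Sector.v₁, Sector.v₂]
  push_cast
  ring

/-- The cross product of the two directions bounding a sector. -/
def Sector.width (e : Sector) : ℤ := e.a₁ * e.b₂ - e.a₂ * e.b₁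

/-- Add `w` times the constraint of type `t` attached to the sector `e`: its first side, its
second side, or (otherwise) the chord. -/
def addSector (e : Sector) (t : ℕ) (w : ℤ) (l : List ℤ) : Option (List ℤ) :=
  match t with
  | 0 => some (addForm e (-e.a₂ * 1000000 * w) (e.a₁ * 1000000 * w) 0 l)
  | 1 => some (addForm e (e.b₂ * 1000000 * w) (-e.b₁ * 1000000 * w) 0 l)
  | _ => if 0 < e.width then
      some (addForm e ((e.b₂ - e.a₂) * 1000000 * w) ((e.a₁ - e.b₁) * 1000000 * w)
        (-366 * e.width * w) l)
    else none

/-- Add `w` times one of the nine normalization constraints: seven comparing the windows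
`y (i + 3) - y i`, one from the reflection, and `x 1 ≤ 1 / 2`. -/
def addBase (k : ℕ) (w : ℤ) (l : List ℤ) : List ℤ :=
  if k < 7 then
    bump 0 (1000000000 * ((k + 4) / 8 : ℕ) * w) <|
      bump (2 * ((k + 4) % 8) + 2) (1000000000 * w) <|
        bump (2 * (k + 1) + 2) (-1000000000 * w) <| bump (2 * 3 + 2) (-1000000000 * w) l
  else if k = 7 then
    bump (2 * 3 + 2) (1000000000 * w) <| bump (2 * 2 + 2) (-1000000000 * w) <|
      bump (2 * 1 + 2) (-1000000000 * w) l
  else bump 0 (500000000 * w) <| bump (2 * 1 + 1) (-1000000000 * w) l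

/-- Sum the weighted constraints encoded by the digits of `c` in base `10 ^ 7`: three digits for
the constraint, four for the weight. -/
def collect (st : List Sector) : ℕ → ℕ → List ℤ → Option (List ℤ)
  | 0, _, l => some l
  | fuel + 1, c, l =>
    if c = 0 then some l
    else
      let w := c % 10000
      let r := c / 10000 % 1000
      if r < 9 then collect st fuel (c / 10000000) (addBase r w l)
      else match st[(r - 9) / 3]? with
        | none => none
        | some e => match addSector e ((r - 9) % 3) w l with
          | none => none
          | some l' => collect st fuel (c / 10000000) l'

/-- Sum of the positive coefficients. -/
def posSum : List ℤ → ℤ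
  | [] => 0
  | a :: l => (if 0 ≤ a then a else 0) + posSum l

/-- The form is negative on the unit box (ignoring the variables `x₀ = y₀ = 0`). -/
def negative : List ℤ → Bool
  | c :: _ :: _ :: l => decide (c + posSum l < 0)
  | _ => false

/-- The twenty contacts of the optimal arrangement: end points, lattice shift, and approximate
direction (in thousandths). -/
def contacts : List (ℕ × ℕ × ℤ × ℤ × ℤ × ℤ) :=
  [(0, 1, 0, 0, 1000, 0), (0, 2, -1, 0, -866, -500), (0, 3, -1, 0, -866, 500),
   (0, 6, 0, 0, 500, 866), (0, 7, 0, -1, 500, -866), (1, 2, 0, 0, 866, -500),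
   (1, 3, 0, 0, 866, 500), (1, 6, 0, 0, -500, 866), (1, 7, 0, -1, -500, -866),
   (2, 3, 0, 0, 0, 1000), (2, 4, 0, -1, -500, -866), (2, 5, 0, -1, 500, -866),
   (3, 4, 0, 0, -500, 866), (3, 5, 0, 0, 500, 866), (4, 5, 0, 0, 1000, 0),
   (4, 6, 0, 0, -866, -500), (4, 7, 0, 0, -866, 500), (5, 6, 1, 0, 866, -500),
   (5, 7, 1, 0, 866, 500), (6, 7, 0, 0, 0, 1000)]

/-- The sector `e` confines the contact `f` to a narrow cone around its ideal direction. -/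
def confines (lab : List (ℕ × ℤ × ℤ)) (f : ℕ × ℕ × ℤ × ℤ × ℤ × ℤ) (e : Sector) : Bool :=
  let (a, b, m, n, u₁, u₂) := f
  let (ia, sa, ta) := lab.getD a (0, 0, 0)
  let (ib, sb, tb) := lab.getD b (0, 0, 0)
  decide (0 < e.width) &&
  (decide (e.i = ia ∧ e.j = ib ∧ sb - sa + m = -e.m ∧ tb - ta + n = -e.n ∧
      976000 ≤ e.a₁ * u₁ + e.a₂ * u₂ ∧ 976000 ≤ e.b₁ * u₁ + e.b₂ * u₂) ||
    decide (e.i = ib ∧ e.j = ia ∧ sb - sa + m = e.m ∧ tb - ta + n = e.n ∧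
      e.a₁ * u₁ + e.a₂ * u₂ ≤ -976000 ∧ e.b₁ * u₁ + e.b₂ * u₂ ≤ -976000))

/-- All contacts are confined by the sectors at the positions `pos`. -/
def confinesAll (st : List Sector) (lab : List (ℕ × ℤ × ℤ)) :
    List (ℕ × ℕ × ℤ × ℤ × ℤ × ℤ) → List ℕ → Bool
  | [], _ => true
  | _ :: _, [] => false
  | f :: fs, p :: ps => match st[p]? with
    | none => false
    | some e => confines lab f e && confinesAll st lab fs ps

/-- Every point is a vertex of the labelling. -/
def covers (lab : List (ℕ × ℤ × ℤ)) : Bool :=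
  (List.range 8).all fun i => (List.range 8).any fun a => (lab.getD a (0, 0, 0)).1 == i

/-- The certificate checker. -/
def check : Cert → List Sector → Bool
  | .leaf c, st => match collect st 20 c [] with
    | none => false
    | some l => negative l
  | .near lab pos, st => covers lab && confinesAll st lab contacts pos
  | .split k c₁ c₂ l r, st => match st[k]? with
    | none => false
    | some e => decide (c₁ * c₁ + c₂ * c₂ ≤ 1000000) &&
        (check l ({e with b₁ := c₁, b₂ := c₂} :: st) &&
          check r ({e with a₁ := c₁, a₂ := c₂} :: st))

/-- The initial sector for the points `i < j` and the shift `(m, n)`. -/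
def startSector (i j : ℕ) (n m : ℤ) : Sector :=
  if n = 0 then
    ⟨i, j, m, n, if m = 1 then 0 else 1000, if m = 1 then 1000 else 0,
      if m = -1 ∨ (i = 0 ∧ m = 0) then 0 else -1000,
      if m = -1 ∨ (i = 0 ∧ m = 0) then 1000 else 0⟩
  else
    ⟨i, j, m, n, if m = -1 ∨ (i = 0 ∧ m = 0) then 0 else -1000,
      if m = -1 ∨ (i = 0 ∧ m = 0) then -1000 else 0,
      if m = 1 then 0 else 1000, if m = 1 then -1000 else 0⟩

/-- The list of all initial sectors. -/
def start : List Sector :=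
  (List.range 8).flatMap fun i => (List.range' (i + 1) (7 - i)).flatMap fun j =>
    [0, 1].flatMap fun n => [-1, 0, 1].map fun m => startSector i j n m

/-! ### Directions of the contacts -/

theorem sqrt_three_bounds : 1.732 ≤ √3 ∧ √3 ≤ 1.7321 :=
  ⟨Real.le_sqrt_of_sq_le (by norm_num), Real.sqrt_le_iff.2 ⟨by norm_num, by norm_num⟩⟩

/-- A coordinate of a unit vector from its value in thousandths, `±866` standing for `±√3 / 2`. -/
noncomputable def dir (c : ℤ) : ℝ :=
  if c = 866 then √3 / 2 else if c = -866 then -(√3 / 2) else c / 1000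

theorem two_mul_dir : 2 * dir 866 = √3 ∧ 2 * dir (-866) = -√3 ∧ 2 * dir 500 = 1 ∧
    2 * dir (-500) = -1 ∧ 2 * dir 1000 = 2 ∧ 2 * dir 0 = 0 := by
  norm_num [dir]
  ring

theorem dir_neg (c : ℤ) : dir (-c) = -dir c := by
  unfold dir
  split_ifs <;> first | omega | (push_cast; ring)

theorem abs_dir_sub_le (c : ℤ) : |1000 * dir c - c| ≤ 0.05 := by
  obtain ⟨h₁, h₂⟩ := sqrt_three_bounds
  rw [abs_le]
  unfold dir
  split_ifs with h h
  · subst h; push_cast; constructor <;> linarith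
  · subst h; push_cast; constructor <;> linarith
  · constructor <;> linarith

/-! ### Soundness of the checker -/

/-- The difference vector lies in the sector and is not shorter than `d`. -/
structure Sector.Holds (e : Sector) (d : ℝ) (x y : ℕ → ℝ) : Prop where
  side_a : 0 ≤ e.a₁ * e.v₂ y - e.a₂ * e.v₁ x
  side_b : 0 ≤ e.b₂ * e.v₁ x - e.b₁ * e.v₂ y
  a_le : e.a₁ * e.a₁ + e.a₂ * e.a₂ ≤ 1000000
  b_le : e.b₁ * e.b₁ + e.b₂ * e.b₂ ≤ 1000000
  sep : d ^ 2 ≤ e.v₁ x ^ 2 + e.v₂ y ^ 2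

/-- Eight points of the unit square with pairwise toroidal distances at least `d`, sorted by height
and normalized by the symmetries of the torus. -/
structure Normalized (d : ℝ) (x y : ℕ → ℝ) : Prop where
  d_ge : 0.366 ≤ d
  x_zero : x 0 = 0
  y_zero : y 0 = 0
  x_nonneg : ∀ i, 0 ≤ x i
  x_le : ∀ i, x i ≤ 1
  y_nonneg : ∀ i, 0 ≤ y i
  y_le : ∀ i, y i ≤ 1
  y_mono : ∀ i j, i < j → j < 8 → y i ≤ y j
  window : ∀ k < 7, y (k + 1) + y 3 ≤ y ((k + 4) % 8) + ((k + 4) / 8 : ℕ)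
  reflection : y 1 + y 2 ≤ y 3
  half : x 1 ≤ 1 / 2
  sep : ∀ i j, i < j → j < 8 → ∀ m n : ℤ,
    d ^ 2 ≤ (x j - x i - m) ^ 2 + (y j - y i - n) ^ 2

theorem norm_combination_le {a₁ a₂ b₁ b₂ p q r : ℝ} (hp : 0 ≤ p) (hq : 0 ≤ q)
    (ha : a₁ * a₁ + a₂ * a₂ ≤ r ^ 2) (hb : b₁ * b₁ + b₂ * b₂ ≤ r ^ 2) :
    (q * a₁ + p * b₁) ^ 2 + (q * a₂ + p * b₂) ^ 2 ≤ (r * (p + q)) ^ 2 := by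
  have h : a₁ * b₁ + a₂ * b₂ ≤ r ^ 2 := by nlinarith [sq_nonneg (a₁ - b₁), sq_nonneg (a₂ - b₂)]
  have hpq := mul_le_mul_of_nonneg_left h (mul_nonneg hp hq)
  have hqq := mul_le_mul_of_nonneg_left ha (mul_nonneg hq hq)
  have hpp := mul_le_mul_of_nonneg_left hb (mul_nonneg hp hp)
  nlinarith

/-- A vector of length at least `d` in a convex sector lies beyond the chord. -/
theorem Sector.Holds.chord {e : Sector} {d : ℝ} {x y : ℕ → ℝ} (h : e.Holds d x y)
    (hw : 0 < e.width) :
    d * e.width ≤ 1000 * ((e.a₁ * e.v₂ y - e.a₂ * e.v₁ x) + (e.b₂ * e.v₁ x - e.b₁ * e.v₂ y)) := by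
  have ha : (e.a₁ * e.a₁ + e.a₂ * e.a₂ : ℝ) ≤ 1000 ^ 2 := by
    have := h.a_le
    norm_num
    exact_mod_cast this
  have hb : (e.b₁ * e.b₁ + e.b₂ * e.b₂ : ℝ) ≤ 1000 ^ 2 := by
    have := h.b_le
    norm_num
    exact_mod_cast this
  have hw' : (0 : ℝ) < e.width := by exact_mod_cast hw
  have key := norm_combination_le h.side_a h.side_b ha hb
  have e1 : (e.b₂ * e.v₁ x - e.b₁ * e.v₂ y) * e.a₁ + (e.a₁ * e.v₂ y - e.a₂ * e.v₁ x) * e.b₁ =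
      e.width * e.v₁ x := by
    simp only [Sector.width]; push_cast; ring
  have e2 : (e.b₂ * e.v₁ x - e.b₁ * e.v₂ y) * e.a₂ + (e.a₁ * e.v₂ y - e.a₂ * e.v₁ x) * e.b₂ =
      e.width * e.v₂ y := by
    simp only [Sector.width]; push_cast; ring
  rw [e1, e2] at key
  refine (abs_le_of_sq_le_sq' ?_ ?_).2
  · have := mul_le_mul_of_nonneg_left h.sep (sq_nonneg (e.width : ℝ))
    nlinarith
  · have := h.side_a
    have := h.side_b
    linarith

theorem ev_addSector {e : Sector} {d : ℝ} {x y : ℕ → ℝ} (h : e.Holds d x y) (hd : 0.366 ≤ d)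
    {t : ℕ} {w : ℕ} {l l' : List ℤ} (hl : addSector e t w l = some l') :
    ev (vars x y) 0 l ≤ ev (vars x y) 0 l' := by
  have hw : (0 : ℝ) ≤ w := Nat.cast_nonneg w
  unfold addSector at hl
  split at hl
  · obtain rfl := Option.some.inj hl
    rw [ev_addForm]
    have := mul_nonneg hw h.side_a
    push_cast
    nlinarith
  · obtain rfl := Option.some.inj hl
    rw [ev_addForm]
    have := mul_nonneg hw h.side_b
    push_cast
    nlinarith
  · split at hl
    next hwid =>
      obtain rfl := Option.some.inj hl
      rw [ev_addForm]
      have hwid' : (0 : ℝ) < e.width := by exact_mod_cast hwid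
      have h1 := h.chord hwid
      have h2 := mul_le_mul_of_nonneg_right hd hwid'.le
      have := mul_nonneg hw (sub_nonneg.2 (h2.trans h1))
      push_cast
      nlinarith
    · simp at hl

theorem ev_addBase {d : ℝ} {x y : ℕ → ℝ} (h : Normalized d x y) (k w : ℕ) (l : List ℤ) :
    ev (vars x y) 0 l ≤ ev (vars x y) 0 (addBase k w l) := by
  have hw : (0 : ℝ) ≤ w := Nat.cast_nonneg w
  unfold addBase
  split_ifs with h1 h2
  · simp only [ev_bump, zero_add, vars_zero, vars_y]
    have := mul_nonneg hw (sub_nonneg.2 (h.window k h1))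
    generalize (k + 4) / 8 = q at *
    push_cast
    linarith
  · simp only [ev_bump, zero_add, vars_y]
    have := mul_nonneg hw (sub_nonneg.2 h.reflection)
    push_cast
    linarith
  · simp only [ev_bump, zero_add, vars_zero, vars_x]
    have := mul_nonneg hw (sub_nonneg.2 h.half)
    push_cast
    linarith

theorem ev_collect {d : ℝ} {x y : ℕ → ℝ} (h : Normalized d x y) {st : List Sector}
    (hst : ∀ e ∈ st, e.Holds d x y) (fuel c : ℕ) (l l' : List ℤ)
    (hl : collect st fuel c l = some l') : ev (vars x y) 0 l ≤ ev (vars x y) 0 l' := by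
  induction fuel generalizing c l with
  | zero =>
    obtain rfl := Option.some.inj hl
    rfl
  | succ fuel ih =>
    simp only [collect] at hl
    split at hl
    · obtain rfl := Option.some.inj hl
      rfl
    · split at hl
      · exact (ev_addBase h _ _ l).trans (ih _ _ hl)
      · split at hl
        · simp at hl
        next e he =>
          split at hl
          · simp at hl
          next l₁ hl₁ =>
            exact (ev_addSector (hst e (List.mem_of_getElem? he)) h.d_ge hl₁).trans (ih _ _ hl)

theorem ev_le_posSum {z : ℕ → ℝ} {s : ℕ} (l : List ℤ)
    (hz : ∀ k, s ≤ k → 0 ≤ z k ∧ z k ≤ 1) : ev z s l ≤ posSum l := by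
  induction l generalizing s with
  | nil => simp [ev, posSum]
  | cons a l ih =>
    have h1 := ih (s := s + 1) fun k hk => hz k (by omega)
    have h2 := hz s le_rfl
    simp only [ev, posSum]
    push_cast
    split_ifs with h
    · have : (0 : ℝ) ≤ a := by exact_mod_cast h
      nlinarith
    · have : (a : ℝ) ≤ 0 := by exact_mod_cast (not_le.1 h).le
      nlinarith

theorem ev_neg_of_negative {d : ℝ} {x y : ℕ → ℝ} (h : Normalized d x y) {l : List ℤ}
    (hl : negative l = true) : ev (vars x y) 0 l < 0 := by
  unfold negative at hl
  split at hl
  next c a b l =>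
    have hl' : ((c + posSum l : ℤ) : ℝ) < 0 := by exact_mod_cast of_decide_eq_true hl
    push_cast at hl'
    have hx := vars_x x y 0
    have hy := vars_y x y 0
    norm_num [h.x_zero, h.y_zero] at hx hy
    have := ev_le_posSum (z := vars x y) (s := 3) l fun k _ => by
      rcases Nat.even_or_odd' k with ⟨i, rfl | rfl⟩
      · obtain ⟨i, rfl⟩ : ∃ i', i = i' + 1 := ⟨i - 1, by omega⟩
        rw [show 2 * (i + 1) = 2 * i + 2 by ring, vars_y]
        exact ⟨h.y_nonneg i, h.y_le i⟩
      · rw [vars_x]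
        exact ⟨h.x_nonneg i, h.x_le i⟩
    simp only [ev, vars_zero, hx, hy, zero_add, Nat.reduceAdd]
    linarith
  · simp at hl

/-- The coordinate of the lift of vertex `a` prescribed by a labelling. -/
def lift₁ (lab : List (ℕ × ℤ × ℤ)) (x : ℕ → ℝ) (a : ℕ) : ℝ :=
  x (lab.getD a (0, 0, 0)).1 + (lab.getD a (0, 0, 0)).2.1

/-- The coordinate of the lift of vertex `a` prescribed by a labelling. -/
def lift₂ (lab : List (ℕ × ℤ × ℤ)) (y : ℕ → ℝ) (a : ℕ) : ℝ :=
  y (lab.getD a (0, 0, 0)).1 + (lab.getD a (0, 0, 0)).2.2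

/-- The vector between two lifted vertices is at least `d` long and nearly has the direction of
the contact `f`. -/
def NearContact (d : ℝ) (X Y : ℕ → ℝ) (f : ℕ × ℕ × ℤ × ℤ × ℤ × ℤ) : Prop :=
  d ^ 2 ≤ (X f.2.1 - X f.1 + f.2.2.1) ^ 2 + (Y f.2.1 - Y f.1 + f.2.2.2.1) ^ 2 ∧
    0.9759 * d ≤ dir f.2.2.2.2.1 * (X f.2.1 - X f.1 + f.2.2.1) +
      dir f.2.2.2.2.2 * (Y f.2.1 - Y f.1 + f.2.2.2.1)

/-- The configuration is close to the optimal arrangement. -/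
def NearOptimal (d : ℝ) (x y : ℕ → ℝ) : Prop :=
  ∃ lab : List (ℕ × ℤ × ℤ), (∀ i < 8, ∃ a < 8, (lab.getD a (0, 0, 0)).1 = i) ∧
    ∀ f ∈ contacts, NearContact d (lift₁ lab x) (lift₂ lab y) f

theorem le_dot_dir {a₁ a₂ u₁ u₂ : ℤ} (ha : a₁ * a₁ + a₂ * a₂ ≤ 1000000)
    (h : 976000 ≤ a₁ * u₁ + a₂ * u₂) : 975.9 ≤ a₁ * dir u₁ + a₂ * dir u₂ := by
  have key (a u : ℤ) (ha : a * a ≤ 1000000) : a * u - 50 ≤ 1000 * (a * dir u) := by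
    have h1 : |(a : ℝ)| ≤ 1000 := by
      refine abs_le_of_sq_le_sq ?_ (by norm_num)
      norm_num [sq]
      exact_mod_cast ha
    have h2 := mul_le_mul h1 (abs_dir_sub_le u) (abs_nonneg _) (by norm_num)
    rw [← abs_mul] at h2
    linarith [(abs_le.1 h2).1]
  have h1 := key a₁ u₁ (by nlinarith)
  have h2 := key a₂ u₂ (by nlinarith)
  have h3 : (976000 : ℝ) ≤ a₁ * u₁ + a₂ * u₂ := by exact_mod_cast h
  linarith

theorem Sector.Holds.dot {e : Sector} {d : ℝ} {x y : ℕ → ℝ} (h : e.Holds d x y)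
    (hw : 0 < e.width) {u₁ u₂ : ℤ} (ha : 976000 ≤ e.a₁ * u₁ + e.a₂ * u₂)
    (hb : 976000 ≤ e.b₁ * u₁ + e.b₂ * u₂) :
    0.9759 * d ≤ dir u₁ * e.v₁ x + dir u₂ * e.v₂ y := by
  have hw' : (0 : ℝ) < e.width := by exact_mod_cast hw
  have h1 := mul_le_mul_of_nonneg_left (le_dot_dir h.a_le ha) h.side_b
  have h2 := mul_le_mul_of_nonneg_left (le_dot_dir h.b_le hb) h.side_a
  have h3 := h.chord hw
  have h4 : (e.width : ℝ) * (dir u₁ * e.v₁ x + dir u₂ * e.v₂ y) =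
      (e.b₂ * e.v₁ x - e.b₁ * e.v₂ y) * (e.a₁ * dir u₁ + e.a₂ * dir u₂) +
        (e.a₁ * e.v₂ y - e.a₂ * e.v₁ x) * (e.b₁ * dir u₁ + e.b₂ * dir u₂) := by
    simp only [Sector.width]; push_cast; ring
  refine le_of_mul_le_mul_left ?_ hw'
  rw [h4]
  linarith

theorem nearContact_of_confines {d : ℝ} {x y : ℕ → ℝ} {lab : List (ℕ × ℤ × ℤ)}
    {f : ℕ × ℕ × ℤ × ℤ × ℤ × ℤ} {e : Sector} (he : e.Holds d x y)
    (h : confines lab f e = true) : NearContact d (lift₁ lab x) (lift₂ lab y) f := by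
  obtain ⟨a, b, m, n, u₁, u₂⟩ := f
  simp only [confines, Bool.and_eq_true, Bool.or_eq_true, decide_eq_true_eq] at h
  obtain ⟨hw, ⟨hi, hj, hm, hn, ha, hb⟩ | ⟨hi, hj, hm, hn, ha, hb⟩⟩ := h
  · have e1 : lift₁ lab x b - lift₁ lab x a + m = e.v₁ x := by
      have : (((lab.getD b (0, 0, 0)).2.1 - (lab.getD a (0, 0, 0)).2.1 + m : ℤ) : ℝ) =
        ((-e.m : ℤ) : ℝ) := by exact_mod_cast hm
      push_cast at this
      simp only [lift₁, Sector.v₁, hi, hj]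
      linarith
    have e2 : lift₂ lab y b - lift₂ lab y a + n = e.v₂ y := by
      have : (((lab.getD b (0, 0, 0)).2.2 - (lab.getD a (0, 0, 0)).2.2 + n : ℤ) : ℝ) =
        ((-e.n : ℤ) : ℝ) := by exact_mod_cast hn
      push_cast at this
      simp only [lift₂, Sector.v₂, hi, hj]
      linarith
    simp only [NearContact, e1, e2]
    exact ⟨he.sep, he.dot hw ha hb⟩
  · have e1 : lift₁ lab x b - lift₁ lab x a + m = -e.v₁ x := by
      have : (((lab.getD b (0, 0, 0)).2.1 - (lab.getD a (0, 0, 0)).2.1 + m : ℤ) : ℝ) =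
        ((e.m : ℤ) : ℝ) := by exact_mod_cast hm
      push_cast at this
      simp only [lift₁, Sector.v₁, hi, hj]
      linarith
    have e2 : lift₂ lab y b - lift₂ lab y a + n = -e.v₂ y := by
      have : (((lab.getD b (0, 0, 0)).2.2 - (lab.getD a (0, 0, 0)).2.2 + n : ℤ) : ℝ) =
        ((e.n : ℤ) : ℝ) := by exact_mod_cast hn
      push_cast at this
      simp only [lift₂, Sector.v₂, hi, hj]
      linarith
    simp only [NearContact, e1, e2, neg_sq]
    refine ⟨he.sep, ?_⟩
    have := he.dot hw (u₁ := -u₁) (u₂ := -u₂) (by linarith) (by linarith)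
    rw [dir_neg, dir_neg] at this
    linarith

theorem nearContact_of_confinesAll {d : ℝ} {x y : ℕ → ℝ} {st : List Sector}
    (hst : ∀ e ∈ st, e.Holds d x y) {lab : List (ℕ × ℤ × ℤ)}
    (fs : List (ℕ × ℕ × ℤ × ℤ × ℤ × ℤ)) (ps : List ℕ) (h : confinesAll st lab fs ps = true) :
    ∀ f ∈ fs, NearContact d (lift₁ lab x) (lift₂ lab y) f := by
  induction fs generalizing ps with
  | nil => simp
  | cons f fs ih =>
    cases ps with
    | nil => simp [confinesAll] at h
    | cons p ps =>
      simp only [confinesAll] at h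
      split at h
      · simp at h
      next e he =>
        rw [Bool.and_eq_true] at h
        rw [List.forall_mem_cons]
        exact ⟨nearContact_of_confines (hst e (List.mem_of_getElem? he)) h.1, ih ps h.2⟩

theorem nearOptimal_of_check {d : ℝ} {x y : ℕ → ℝ} (h : Normalized d x y) (c : Cert)
    (st : List Sector) (hst : ∀ e ∈ st, e.Holds d x y) (hc : check c st = true) :
    NearOptimal d x y := by
  induction c generalizing st with
  | leaf c =>
    simp only [check] at hc
    split at hc
    · simp at hc
    next l hl =>
      have h1 := ev_collect h hst _ _ _ _ hl
      have h2 := ev_neg_of_negative h hc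
      simp only [ev] at h1
      linarith
  | near lab pos =>
    simp only [check, Bool.and_eq_true, covers, List.all_eq_true, List.any_eq_true,
      List.mem_range, beq_iff_eq] at hc
    exact ⟨lab, hc.1, nearContact_of_confinesAll hst _ _ hc.2⟩
  | split k c₁ c₂ l r ihl ihr =>
    simp only [check] at hc
    split at hc
    · simp at hc
    next e he =>
      simp only [Bool.and_eq_true, decide_eq_true_eq] at hc
      obtain ⟨hle, hl, hr⟩ := hc
      have hE := hst e (List.mem_of_getElem? he)
      rcases le_total 0 (c₂ * e.v₁ x - c₁ * e.v₂ y) with hs | hs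
      · refine ihl _ ?_ hl
        rw [List.forall_mem_cons]
        exact ⟨⟨hE.side_a, hs, hE.a_le, hle, hE.sep⟩, hst⟩
      · refine ihr _ ?_ hr
        rw [List.forall_mem_cons]
        refine ⟨⟨?_, hE.side_b, hle, hE.b_le, hE.sep⟩, hst⟩
        change 0 ≤ c₁ * e.v₂ y - c₂ * e.v₁ x
        linarith

theorem holds_startSector {d : ℝ} {x y : ℕ → ℝ} (h : Normalized d x y) {i j : ℕ} (hij : i < j)
    (hj : j < 8) {m n : ℤ} (hm : m = -1 ∨ m = 0 ∨ m = 1) (hn : n = 0 ∨ n = 1) :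
    (startSector i j n m).Holds d x y := by
  have hy := h.y_mono i j hij hj
  have hs := h.sep i j hij hj m n
  have := h.x_nonneg i
  have := h.x_nonneg j
  have := h.x_le i
  have := h.x_le j
  have := h.y_nonneg i
  have := h.y_le j
  have hx := h.x_zero
  rcases hm with rfl | rfl | rfl <;> rcases hn with rfl | rfl <;> by_cases hi : i = 0 <;>
    simp only [startSector] <;> norm_num [hi] <;>
    refine ⟨?_, ?_, by norm_num, by norm_num, ?_⟩ <;>
    simp only [Sector.v₁, Sector.v₂] <;> push_cast <;>
    first | (subst hi; linarith) | linarith | (subst hi; simpa using hs) | simpa using hs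

theorem holds_start {d : ℝ} {x y : ℕ → ℝ} (h : Normalized d x y) :
    ∀ e ∈ start, e.Holds d x y := by
  intro e he
  simp only [start, List.mem_flatMap, List.mem_map, List.mem_range, List.mem_range'_1,
    List.mem_cons, List.not_mem_nil, or_false] at he
  obtain ⟨i, hi, j, ⟨hij, hj⟩, n, hn, m, hm, rfl⟩ := he
  exact holds_startSector h (by omega) (by omega) hm hn

/-! ### Rigidity of the optimal arrangement -/

/-- Component of the relative displacement of the end points of `f` along the contact. -/
noncomputable def radial (X Y : ℕ → ℝ) (f : ℕ × ℕ × ℤ × ℤ × ℤ × ℤ) : ℝ :=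
  dir f.2.2.2.2.1 * (X f.2.1 - X f.1) + dir f.2.2.2.2.2 * (Y f.2.1 - Y f.1)

/-- Component of the relative displacement of the end points of `f` orthogonal to the contact. -/
noncomputable def tangential (X Y : ℕ → ℝ) (f : ℕ × ℕ × ℤ × ℤ × ℤ × ℤ) : ℝ :=
  dir f.2.2.2.2.1 * (Y f.2.1 - Y f.1) - dir f.2.2.2.2.2 * (X f.2.1 - X f.1)

theorem two_mul_radial (X Y : ℕ → ℝ) (f : ℕ × ℕ × ℤ × ℤ × ℤ × ℤ) : 2 * radial X Y f =
    2 * dir f.2.2.2.2.1 * (X f.2.1 - X f.1) + 2 * dir f.2.2.2.2.2 * (Y f.2.1 - Y f.1) := by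
  rw [radial]; ring

theorem two_mul_tangential (X Y : ℕ → ℝ) (f : ℕ × ℕ × ℤ × ℤ × ℤ × ℤ) : 2 * tangential X Y f =
    2 * dir f.2.2.2.2.1 * (Y f.2.1 - Y f.1) - 2 * dir f.2.2.2.2.2 * (X f.2.1 - X f.1) := by
  rw [tangential]; ring

set_option maxHeartbeats 4000000 in
/-- Almost nonnegative radial displacements bound the tangential ones. -/
theorem abs_tangential_le {X Y : ℕ → ℝ} {H : ℝ} (hH : 0 ≤ H)
    (h : ∀ f ∈ contacts, -H ≤ radial X Y f) : ∀ f ∈ contacts, |tangential X Y f| ≤ 9 * H := by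
  obtain ⟨h₁, h₂⟩ := sqrt_three_bounds
  have hs : √3 * √3 = 3 := Real.mul_self_sqrt (by norm_num)
  have hsum (e : ℝ) (he : -H ≤ e) : 1732 * (2 * e + 2 * H) ≤ 1000 * (√3 * (2 * e + 2 * H)) ∧
      10000 * (√3 * (2 * e + 2 * H)) ≤ 17321 * (2 * e + 2 * H) := ⟨by nlinarith, by nlinarith⟩
  obtain ⟨cH, dH⟩ := hsum 0 (by linarith)
  have hassoc (t : ℝ) : √3 * (√3 * t) = 3 * t := by rw [← mul_assoc, hs]
  replace h := fun f hf => hsum _ (h f hf)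
  suffices g : ∀ f ∈ contacts, 2 * tangential X Y f ≤ 18 * H ∧ -(2 * tangential X Y f) ≤ 18 * H from
    fun f hf => abs_le'.2 ⟨by linarith [g f hf], by linarith [g f hf]⟩
  obtain ⟨D₁, D₂, D₃, D₄, D₅, D₆⟩ := two_mul_dir
  simp only [contacts, List.forall_mem_cons, List.not_mem_nil, false_imp_iff, implies_true,
    and_true, two_mul_radial, two_mul_tangential, D₁, D₂, D₃, D₄, D₅, D₆] at h ⊢
  simp only [zero_add, zero_mul, one_mul, sub_zero, add_zero, neg_mul, mul_sub, mul_add, mul_neg,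
    mul_zero, hassoc, mul_left_comm √3 2] at h cH dH ⊢
  clear D₁ D₂ D₃ D₄ D₅ D₆ hassoc
  generalize √3 = s at *
  obtain ⟨⟨c0, d0⟩, ⟨c1, d1⟩, ⟨c2, d2⟩, ⟨c3, d3⟩, ⟨c4, d4⟩, ⟨c5, d5⟩, ⟨c6, d6⟩, ⟨c7, d7⟩, ⟨c8,
      d8⟩, ⟨c9, d9⟩, ⟨c10, d10⟩, ⟨c11, d11⟩, ⟨c12, d12⟩, ⟨c13, d13⟩, ⟨c14, d14⟩, ⟨c15, d15⟩, ⟨c16,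
      d16⟩, ⟨c17, d17⟩, ⟨c18, d18⟩, ⟨c19, d19⟩⟩ := h
  refine ⟨⟨?_, ?_⟩, ⟨?_, ?_⟩, ⟨?_, ?_⟩, ⟨?_, ?_⟩, ⟨?_, ?_⟩, ⟨?_, ?_⟩, ⟨?_, ?_⟩, ⟨?_, ?_⟩, ⟨?_,
      ?_⟩, ⟨?_, ?_⟩, ⟨?_, ?_⟩, ⟨?_, ?_⟩, ⟨?_, ?_⟩, ⟨?_, ?_⟩, ⟨?_, ?_⟩, ⟨?_, ?_⟩, ⟨?_, ?_⟩, ⟨?_,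
      ?_⟩, ⟨?_, ?_⟩, ⟨?_, ?_⟩⟩
  · linarith only [c1, d1, c2, d2, c4, d4, c5, d5, c6, d6, c7, d7, c11, d11, c12, d12, c14, d14,
      c16, d16, c17, d17, c19, d19, cH, dH]
  · linarith only [c1, d1, c2, d2, c3, d3, c5, d5, c6, d6, c8, d8, c10, d10, c13, d13, c14, d14,
      c15, d15, c18, d18, c19, d19, cH, dH]
  · linarith only [c0, d0, c1, d1, c2, d2, c3, d3, c6, d6, c8, d8, c10, d10, c11, d11, c12, d12,
      c14, d14, c15, d15, c17, d17, c18, d18, c19, d19, cH, dH]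
  · linarith only [c0, d0, c1, d1, c2, d2, c4, d4, c5, d5, c7, d7, c9, d9, c11, d11, c12, d12,
      c14, d14, c16, d16, c17, d17, c19, d19, cH, dH]
  · linarith only [c0, d0, c1, d1, c2, d2, c3, d3, c6, d6, c8, d8, c9, d9, c10, d10, c13, d13,
      c14, d14, c15, d15, c18, d18, c19, d19, cH, dH]
  · linarith only [c0, d0, c1, d1, c2, d2, c4, d4, c5, d5, c7, d7, c10, d10, c12, d12, c13, d13,
      c14, d14, c16, d16, c17, d17, c18, d18, c19, d19, cH, dH]
  · linarith only [c0, d0, c3, d3, c4, d4, c5, d5, c7, d7, c9, d9, c11, d11, c12, d12, c13, d13,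
      c14, d14, c16, d16, c17, d17, c19, d19, cH, dH]
  · linarith only [c1, d1, c2, d2, c3, d3, c5, d5, c7, d7, c8, d8, c9, d9, c10, d10, c12, d12,
      c13, d13, c14, d14, c15, d15, c18, d18, c19, d19, cH, dH]
  · linarith only [c1, d1, c2, d2, c4, d4, c6, d6, c7, d7, c8, d8, c9, d9, c10, d10, c11, d11,
      c12, d12, c14, d14, c16, d16, c17, d17, c19, d19, cH, dH]
  · linarith only [c0, d0, c3, d3, c4, d4, c6, d6, c8, d8, c9, d9, c10, d10, c11, d11, c13, d13,
      c14, d14, c15, d15, c18, d18, c19, d19, cH, dH]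
  · linarith only [c0, d0, c1, d1, c3, d3, c5, d5, c6, d6, c8, d8, c9, d9, c13, d13, c14, d14,
      c15, d15, c16, d16, c18, d18, c19, d19, cH, dH]
  · linarith only [c0, d0, c2, d2, c4, d4, c5, d5, c6, d6, c7, d7, c10, d10, c11, d11, c13, d13,
      c14, d14, c15, d15, c16, d16, c17, d17, c19, d19, cH, dH]
  · linarith only [c0, d0, c1, d1, c3, d3, c5, d5, c6, d6, c8, d8, c11, d11, c12, d12, c13, d13,
      c14, d14, c15, d15, c16, d16, c18, d18, c19, d19, cH, dH]
  · linarith only [c0, d0, c2, d2, c4, d4, c5, d5, c6, d6, c7, d7, c9, d9, c11, d11, c14, d14,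
      c15, d15, c16, d16, c17, d17, c19, d19, cH, dH]
  · linarith only [c1, d1, c3, d3, c4, d4, c5, d5, c6, d6, c7, d7, c9, d9, c11, d11, c12, d12,
      c13, d13, c14, d14, c16, d16, c17, d17, c19, d19, cH, dH]
  · linarith only [c0, d0, c1, d1, c3, d3, c6, d6, c7, d7, c8, d8, c9, d9, c10, d10, c13, d13,
      c14, d14, c15, d15, c18, d18, c19, d19, cH, dH]
  · linarith only [c0, d0, c2, d2, c4, d4, c5, d5, c7, d7, c8, d8, c9, d9, c11, d11, c12, d12,
      c14, d14, c16, d16, c17, d17, c19, d19, cH, dH]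
  · linarith only [c2, d2, c3, d3, c4, d4, c5, d5, c6, d6, c8, d8, c9, d9, c10, d10, c11, d11,
      c13, d13, c14, d14, c15, d15, c18, d18, c19, d19, cH, dH]
  · linarith only [c0, d0, c1, d1, c3, d3, c6, d6, c8, d8, c10, d10, c11, d11, c12, d12, c13, d13,
      c15, d15, c18, d18, c19, d19, cH, dH]
  · linarith only [c0, d0, c2, d2, c4, d4, c5, d5, c7, d7, c10, d10, c11, d11, c12, d12, c13, d13,
      c16, d16, c17, d17, c19, d19, cH, dH]
  · linarith only [c0, d0, c2, d2, c4, d4, c5, d5, c7, d7, c8, d8, c9, d9, c10, d10, c11, d11,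
      c12, d12, c14, d14, c17, d17, c19, d19, cH, dH]
  · linarith only [c0, d0, c1, d1, c3, d3, c4, d4, c6, d6, c8, d8, c9, d9, c10, d10, c11, d11,
      c13, d13, c15, d15, c16, d16, c17, d17, c19, d19, cH, dH]
  · linarith only [c0, d0, c2, d2, c4, d4, c5, d5, c7, d7, c8, d8, c9, d9, c10, d10, c11, d11,
      c12, d12, c15, d15, c17, d17, c18, d18, c19, d19, cH, dH]
  · linarith only [c0, d0, c1, d1, c3, d3, c6, d6, c8, d8, c9, d9, c10, d10, c11, d11, c13, d13,
      c14, d14, c15, d15, c18, d18, c19, d19, cH, dH]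
  · linarith only [c0, d0, c2, d2, c3, d3, c4, d4, c5, d5, c7, d7, c9, d9, c11, d11, c12, d12,
      c13, d13, c15, d15, c16, d16, c18, d18, c19, d19, cH, dH]
  · linarith only [c0, d0, c1, d1, c3, d3, c6, d6, c8, d8, c9, d9, c10, d10, c12, d12, c13, d13,
      c14, d14, c15, d15, c18, d18, c19, d19, cH, dH]
  · linarith only [c0, d0, c2, d2, c4, d4, c5, d5, c7, d7, c9, d9, c11, d11, c12, d12, c13, d13,
      c14, d14, c16, d16, c17, d17, c19, d19, cH, dH]
  · linarith only [c0, d0, c1, d1, c3, d3, c6, d6, c7, d7, c8, d8, c9, d9, c10, d10, c12, d12,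
      c13, d13, c16, d16, c17, d17, c18, d18, c19, d19, cH, dH]
  · linarith only [c0, d0, c2, d2, c4, d4, c5, d5, c7, d7, c9, d9, c11, d11, c12, d12, c15, d15,
      c16, d16, c17, d17, c18, d18, cH, dH]
  · linarith only [c0, d0, c1, d1, c3, d3, c6, d6, c8, d8, c9, d9, c10, d10, c13, d13, c15, d15,
      c16, d16, c17, d17, c18, d18, cH, dH]
  · linarith only [c0, d0, c1, d1, c3, d3, c4, d4, c5, d5, c6, d6, c7, d7, c9, d9, c10, d10, c13,
      d13, c14, d14, c15, d15, c16, d16, c18, d18, cH, dH]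
  · linarith only [c0, d0, c2, d2, c4, d4, c5, d5, c7, d7, c9, d9, c11, d11, c12, d12, c14, d14,
      c15, d15, c16, d16, c17, d17, c19, d19, cH, dH]
  · linarith only [c0, d0, c1, d1, c3, d3, c6, d6, c8, d8, c9, d9, c10, d10, c13, d13, c14, d14,
      c15, d15, c16, d16, c18, d18, c19, d19, cH, dH]
  · linarith only [c0, d0, c2, d2, c3, d3, c4, d4, c5, d5, c6, d6, c8, d8, c9, d9, c11, d11, c12,
      d12, c14, d14, c15, d15, c16, d16, c17, d17, cH, dH]
  · linarith only [c0, d0, c1, d1, c3, d3, c6, d6, c8, d8, c9, d9, c10, d10, c13, d13, c14, d14,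
      c15, d15, c17, d17, c18, d18, c19, d19, cH, dH]
  · linarith only [c0, d0, c1, d1, c2, d2, c3, d3, c5, d5, c7, d7, c8, d8, c9, d9, c11, d11, c12,
      d12, c14, d14, c16, d16, c17, d17, c18, d18, cH, dH]
  · linarith only [c0, d0, c1, d1, c2, d2, c4, d4, c6, d6, c7, d7, c8, d8, c9, d9, c10, d10, c13,
      d13, c14, d14, c15, d15, c17, d17, c18, d18, cH, dH]
  · linarith only [c0, d0, c1, d1, c2, d2, c5, d5, c7, d7, c9, d9, c11, d11, c12, d12, c14, d14,
      c16, d16, c17, d17, c18, d18, c19, d19, cH, dH]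
  · linarith only [c1, d1, c3, d3, c4, d4, c6, d6, c7, d7, c8, d8, c9, d9, c10, d10, c13, d13,
      c14, d14, c15, d15, c18, d18, cH, dH]
  · linarith only [c2, d2, c3, d3, c4, d4, c5, d5, c7, d7, c8, d8, c9, d9, c11, d11, c12, d12,
      c14, d14, c16, d16, c17, d17, cH, dH]

/-- The equilibrium stress of the contact graph. -/
noncomputable def stress (f : ℕ × ℕ × ℤ × ℤ × ℤ × ℤ) : ℝ :=
  if 2 ∣ f.1 ∧ f.2.1 = f.1 + 1 then √3 - 1 else 1

theorem stress_pos (f : ℕ × ℕ × ℤ × ℤ × ℤ × ℤ) : 0 < stress f := by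
  unfold stress
  split_ifs <;> linarith [sqrt_three_bounds.1]

theorem sum_stress_mul_radial (X Y : ℕ → ℝ) :
    (contacts.map fun f => stress f * radial X Y f).sum = 0 := by
  norm_num [contacts, stress, radial, dir]
  ring

theorem radial_eq_zero {X Y : ℕ → ℝ} (h : ∀ f ∈ contacts, 0 ≤ radial X Y f) :
    ∀ f ∈ contacts, radial X Y f = 0 := by
  intro f hf
  have h1 := List.single_le_sum (l := contacts.map fun f => stress f * radial X Y f)
    (List.forall_mem_map.2 fun g hg => mul_nonneg (stress_pos g).le (h g hg)) _
    (List.mem_map_of_mem hf)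
  rw [sum_stress_mul_radial] at h1
  exact le_antisymm (nonpos_of_mul_nonpos_right h1 (stress_pos f)) (h f hf)

/-- The displacements of a nearly optimal configuration vanish along all contacts. -/
theorem displacement_eq_zero {X Y : ℕ → ℝ}
    (h : ∀ f ∈ contacts, 1 ≤ (1 + radial X Y f) ^ 2 + tangential X Y f ^ 2 ∧
      -0.0241 ≤ radial X Y f) :
    ∀ f ∈ contacts, radial X Y f = 0 ∧ tangential X Y f = 0 := by
  obtain ⟨g, hg, hmin⟩ := contacts.toFinset.exists_min_image (radial X Y)
    ⟨_, List.mem_toFinset.2 (List.head_mem (by simp [contacts]))⟩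
  simp only [List.mem_toFinset] at hg hmin
  have hneg : radial X Y g ≤ 0 := by
    by_contra! hpos
    exact hpos.ne' (radial_eq_zero (fun f hf => hpos.le.trans (hmin f hf)) g hg)
  have ht := abs_tangential_le (H := -radial X Y g) (by linarith) (by simpa using hmin)
  have hzero : radial X Y g = 0 := by
    have h1 := abs_le.1 (ht g hg)
    have h2 := h g hg
    have h3 : tangential X Y g ^ 2 ≤ (9 * -radial X Y g) ^ 2 := sq_le_sq' (by linarith) h1.2
    nlinarith
  intro f hf
  refine ⟨radial_eq_zero (fun f hf => hzero ▸ hmin f hf) f hf, ?_⟩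
  have := ht f hf
  rw [hzero] at this
  simpa using this

/-- First coordinates of the optimal arrangement, in units of the contact length. -/
noncomputable def ideal₁ (a : ℕ) : ℝ :=
  [-(1 / 2), 1 / 2, (1 + √3) / 2, (1 + √3) / 2, √3 / 2, 1 + √3 / 2, 0, 0].getD a 0

/-- Second coordinates of the optimal arrangement, in units of the contact length. -/
noncomputable def ideal₂ (a : ℕ) : ℝ :=
  [0, 0, -(1 / 2), 1 / 2, (1 + √3) / 2, (1 + √3) / 2, √3 / 2, 1 + √3 / 2].getD a 0

theorem ideal_contact : ∀ f ∈ contacts,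
    ideal₁ f.2.1 - ideal₁ f.1 + (1 + √3) * f.2.2.1 = dir f.2.2.2.2.1 ∧
      ideal₂ f.2.1 - ideal₂ f.1 + (1 + √3) * f.2.2.2.1 = dir f.2.2.2.2.2 ∧
      dir f.2.2.2.2.1 ^ 2 + dir f.2.2.2.2.2 ^ 2 = 1 := by
  have hs : √3 ^ 2 = 3 := Real.sq_sqrt (by norm_num)
  simp only [contacts, List.forall_mem_cons, List.not_mem_nil, false_imp_iff, implies_true,
    and_true]
  refine ⟨?_, ?_, ?_, ?_, ?_, ?_, ?_, ?_, ?_, ?_, ?_, ?_, ?_, ?_, ?_, ?_, ?_, ?_, ?_, ?_⟩ <;>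
    refine ⟨?_, ?_, ?_⟩ <;> norm_num [ideal₁, ideal₂, dir, div_pow, hs] <;> ring

/-- Contacts determine the optimal arrangement up to translation. -/
theorem displacement_eq {X Y : ℕ → ℝ}
    (h : ∀ f ∈ contacts, radial X Y f = 0 ∧ tangential X Y f = 0) :
    ∀ a < 8, X a = X 0 ∧ Y a = Y 0 := by
  have key : ∀ f ∈ contacts, X f.2.1 = X f.1 ∧ Y f.2.1 = Y f.1 := by
    intro f hf
    obtain ⟨-, -, hu⟩ := ideal_contact f hf
    obtain ⟨h1, h2⟩ := h f hf
    rw [radial] at h1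
    rw [tangential] at h2
    constructor
    · linear_combination dir f.2.2.2.2.1 * h1 - dir f.2.2.2.2.2 * h2 -
        (X f.2.1 - X f.1) * hu
    · linear_combination dir f.2.2.2.2.2 * h1 + dir f.2.2.2.2.1 * h2 -
        (Y f.2.1 - Y f.1) * hu
  simp only [contacts, List.forall_mem_cons] at key
  intro a ha
  interval_cases a <;> grind

/-- The configuration is a translate of the scaled optimal arrangement, modulo the lattice. -/
def IsOptimal {ι : Type*} (d : ℝ) (x y : ι → ℝ) : Prop :=
  ∃ t₁ t₂ : ℝ, ∀ i, ∃ a < 8, ∃ m n : ℤ,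
    x i = d * ideal₁ a + t₁ + m ∧ y i = d * ideal₂ a + t₂ + n

theorem NearOptimal.isOptimal {d : ℝ} {x y : ℕ → ℝ} (hd : d * (1 + √3) = 1)
    (h : NearOptimal d x y) : IsOptimal d (fun i : Fin 8 => x i) (fun i : Fin 8 => y i) := by
  obtain ⟨lab, hlab, h⟩ := h
  set X := lift₁ lab x with hX
  set Y := lift₂ lab y with hY
  set L := 1 + √3 with hL
  have hL0 : 0 < L := by positivity
  have key := displacement_eq <| displacement_eq_zero (X := fun a => L * X a - ideal₁ a)
      (Y := fun a => L * Y a - ideal₂ a) fun f hf => by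
    obtain ⟨h1, h2, hu⟩ := ideal_contact f hf
    obtain ⟨g1, g2⟩ := h f hf
    rw [← hL] at h1 h2
    set u := dir f.2.2.2.2.1
    set v := dir f.2.2.2.2.2
    have e1 : L * (X f.2.1 - X f.1 + f.2.2.1) =
        L * X f.2.1 - ideal₁ f.2.1 - (L * X f.1 - ideal₁ f.1) + u := by
      linear_combination h1
    have e2 : L * (Y f.2.1 - Y f.1 + f.2.2.2.1) =
        L * Y f.2.1 - ideal₂ f.2.1 - (L * Y f.1 - ideal₂ f.1) + v := by
      linear_combination h2
    have g1' := mul_le_mul_of_nonneg_left g1 (sq_nonneg L)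
    have g2' := mul_le_mul_of_nonneg_left g2 hL0.le
    rw [mul_add, mul_left_comm L u, mul_left_comm L v, e1, e2] at g2'
    rw [mul_add, ← mul_pow, ← mul_pow, ← mul_pow, e1, e2, mul_comm L d, hd] at g1'
    simp only [radial, tangential]
    generalize L * X f.2.1 - ideal₁ f.2.1 - (L * X f.1 - ideal₁ f.1) = p at *
    generalize L * Y f.2.1 - ideal₂ f.2.1 - (L * Y f.1 - ideal₂ f.1) = q at *
    constructor
    · have : (1 + (u * p + v * q)) ^ 2 + (u * q - v * p) ^ 2 = (p + u) ^ 2 + (q + v) ^ 2 := by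
        linear_combination (p ^ 2 + q ^ 2 - 1) * hu
      linarith
    · have : L * (0.9759 * d) = 0.9759 := by linear_combination 0.9759 * hd
      linarith
  refine ⟨d * (L * X 0 - ideal₁ 0), d * (L * Y 0 - ideal₂ 0), fun i => ?_⟩
  obtain ⟨a, ha, hi⟩ := hlab i i.2
  obtain ⟨k1, k2⟩ := key a ha
  refine ⟨a, ha, -(lab.getD a (0, 0, 0)).2.1, -(lab.getD a (0, 0, 0)).2.2, ?_, ?_⟩
  · have : x i = X a - (lab.getD a (0, 0, 0)).2.1 := by
      rw [hX, lift₁, hi]; ring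
    push_cast
    linear_combination this + d * k1 - X a * hd
  · have : y i = Y a - (lab.getD a (0, 0, 0)).2.2 := by
      rw [hY, lift₂, hi]; ring
    push_cast
    linear_combination this + d * k2 - Y a * hd

/-! ### The certificate -/

def subtree1 : Cert :=
  .split 7 906 422 (.leaf 100032011005101900400200022029003703600110380059) (.split 2 743 669
  (.leaf 80071010010603900010410166) (.split 55 500 (-866)
  (.leaf 3003501000090110061014001301700560260092035002504400662940010) (.split 3 (-798) (-601)
  (.leaf 80069010006901101070140080) (.split 9 (-529) 848 (.split 59 (-891) (-453)
  (.leaf 30170007006901100450130140014075901700960230328026006803400480530129)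
  (.leaf 3003500900220110018013004401400700230095)) (.split 0 (-939) 342 (.split 5 798 601
  (.leaf 100044011005401400710370045038001405400080560068) (.split 61 (-707) (-707)
  (.split 4 601 (-798) (.split 0 (-669) (-743)
  (.leaf 3009401104460200317023006003200730350021047033606500903150060)
  (.leaf 3003200900020110024020007202300390350010047007706500553150014)) (.split 7 258 965
  (.split 18 (-656) 754 (.split 5 (-694) 719
  (.leaf 300250100016011008801400940170053019000502000430230022) (.split 4 (-798) (-601)
  (.split 4 788 (-615) (.leaf 3004801000340110114017009502002000320104059011908600043270011)
  (.split 1 (-951) (-309)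
  (.leaf 2000700301330050007007005901000260110663014094702002630230598035031106203300980213)
  (.split 3 (-788) 615 (.leaf 300510100038011022401401570170204026018902901061010014)
  (.split 6 629 777 (.leaf 30036010004101300060140066017011002001430290290041005006600080680064)
  (.split 187 (-920) 390 (.split 164 707 707
  (.leaf 30005007000601100280250005026000804600040470052074006611000201940009) (.split 1 (-731) 681
  (.split 0 374 927 (.split 173 0 1000 (.leaf 110018055000305600470810005083006511900182210018)
  (.split 198 0 1000 (.split 0 707 707 (.split 188 0 1000
  (.leaf 30019005010101101730140245035004103802180410593053017906506110920772119005312801655210173)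
  (.split 176 809 587 (.split 1 (-927) 374
  (.leaf 100600050050011004401400470290030041013504400670470108050001705902630710144097002709800891340006)
  (.leaf 100420030004005002501101290140082029005204101060470201050004505901200710152097001109801341340039))
  (.leaf 5009400900480110068041027805603920680204095025212200153630006)))
  (.leaf 200190090008011001903200560380058041007505000631250006))
  (.leaf 1100170140017031000703200700370006038008604500050470072)))
  (.leaf 1000901100170170006026004902900510320085039000304100650530029079000308000241160015))
  (.leaf 200010050001011018301400360220029023016002600100290250038020305000250750004077003211300301970027)))
  (.leaf 3009200900700110079014000601702720230258032038304401950710247098001710700571910058))))))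
  (.leaf 3009700700230090074011041801401930170405029021105602410830008)))
  (.leaf 300680070002009007801101700140191017013902000800230142026008905001503180025))
  (.leaf 100520020007004005200500070090045011051702000780230049046003104700090830025)))
  (.leaf 3007400900310110074014016801700900290024041017905901283090032))) (.split 5 754 656
  (.leaf 200030050003011014001200270140069037000103801060540036)
  (.leaf 201790050179011081001203330140292036012503808790560509)))))))

def subtree2 : Cert :=
  .split 9 (-642) 766 (.split 11 (-601) 798 (.split 4 (-829) (-559) (.split 10 (-798) 601
  (.leaf 30025010002801100010140092020010802100060230050026010203200171190100) (.split 2 (-422) 906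
  (.leaf 1000240110033017010202900270350068050004712100061220085) (.split 20 707 707
  (.split 201 0 1000
  (.leaf 50041011007001400990170022020005802302700290061041019004700400560195127001012803525600070)
  (.split 10 978 207 (.split 13 309 951 (.split 159 (-207) (-978)
  (.leaf 30010010002601700730290067038006404100390440113063000113600061370030) (.split 0 207 (-978)
  (.split 170 951 309 (.leaf 10080010010304701230650045069006407100635760005) (.split 194 743 669
  (.split 91 309 (-951)
  (.leaf 100024011000401400340290110036000403800320560031077003814800051490068)
  (.split 128 (-669) (-743)
  (.leaf 5002201000260140003017002502900340410048044001804700210530041059004608000371520067)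
  (.split 180 (-207) 978 (.split 9 (-743) 669
  (.leaf 500230100010011002103500160380007050002005901000620048086004115800745910023)
  (.split 3 669 (-743) (.split 3 (-309) (-951) (.split 154 (-669) 743 (.split 4 207 978
  (.leaf 50002010004901700150230068047000806500060700006071001407200060740159077000209200631130001)
  (.split 8 951 309 (.leaf 1000200110094026005309500506600001) (.split 35 669 743
  (.leaf 10002801100170140054026006702900500560096065004606800240700017071007610400481760087)
  (.split 31 743 669 (.split 56 669 743
  (.leaf 100220050007010002201102380140095017002902000200350011059001606200910770087083013408600690890064)
  (.split 5 (-309) 951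
  (.leaf 500020110013017004702000290230002026000703200030560022065006508000540860029089001709200271070007)
  (.split 14 743 669 (.split 33 (-978) 207
  (.leaf 500050100022020010702300530260030029000903200040440005062002607100630860052092004009500240980023)
  (.split 11 (-951) 309 (.split 6 309 951
  (.near [(0, 0, 0), (1, 0, 0), (7, 0, -1), (2, 0, 0), (5, 0, 0), (4, 0, 0), (3, 0, 0), (6, 0, 0)]
  [22, 27, 26, 21, 12, 31, 6, 29, 11, 19, 0, 25, 4, 5, 2, 3, 1, 30, 8, 9])
  (.leaf 1001400900170110054017006506800340980087101005210400606300006))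
  (.leaf 900140110039014005602300520260026029001903200460350005065001207400470890039095001209800071010021)))
  (.leaf 900220110012016000801700850200069023003702600520380064041004806800740770005083011508901470950088))))
  (.leaf 100260090018011010401400340170014029001703200130560041059007606800120740108080004908600871790022)))))
  (.leaf 1000500900250170032020002803200180470007059003606800270710016095001416700966000019))
  (.leaf 2002000300070090024011002301700670440036059003006502830680170071002908600621070001))
  (.leaf 5004300900450140050038000105000540530001055002605600760620257065015306801710830046089000310400011610005)))
  (.leaf 500580090011011004802000860420010044008305603760620080083009615400121550174))))
  (.leaf 50024009001101100210230016026000803800200470100050004807400411460075)))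
  (.leaf 900300200140029006703501160470031068005413800131400012)))
  (.leaf 30024009004701100150140210021002503400270380088041009906200011340002))
  (.leaf 300270060007009005101100630240018026002203100100320140035005405900341310084)))
  (.leaf 200190090008011001902000690260055032007703800230440036))))
  (.leaf 30081009010701109830140106017048902002930290004041005904401861160342))
  (.leaf 3002500900250110032014014901700890200101))
  (.leaf 300370090032011018801401030170148020011402300380290080038006410900081100116)

def subtree3 : Cert :=
  .split 58 484 (-874) (.leaf 30023010000601100420140011017002202000170300006032006404400070530030)
  (.split 5 (-788) (-615) (.leaf 80070010007201101080140080) (.split 61 (-469) (-882)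
  (.split 4 573 819 (.split 14 (-933) 358 (.split 5 (-529) 848
  (.leaf 30034007003401000530110215022000902300150470153) (.split 3 (-694) (-719)
  (.split 5 121 (-992) (.split 7 694 (-719)
  (.leaf 30214010012801105960200134023011002602660440172054004005605490770302)
  (.split 1 (-390) (-920) (.leaf 3002401100550120005014001802300130290051047002005901070800018)
  (.leaf 30022009000301100400230014026001102900270470018057000405900560800031)))
  (.split 0 601 (-798) (.leaf 30026010001001100410200016023001302600320440021054000505600660770036)
  (.split 4 (-587) 809 (.leaf 30039006000100700010100019011012201300070140066020003404700650800057)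
  (.split 191 0 1000 (.split 162 0 1000 (.leaf 110018033000303500400640004065008710400181880018)
  (.split 187 0 1000 (.split 176 0 1000
  (.leaf 30007007000701000190110005025000203200320410049070001207100781100023) (.split 0 (-707) 707
  (.split 0 (-241) 970
  (.leaf 600210070002010003801101450310012038003904700690650016077019909800141160022)
  (.split 29 (-754) 656 (.split 13 913 406
  (.leaf 200200030071005002000600710100474011369901412510350732047020808203781220099)
  (.split 12 (-707) 707 (.leaf 30040010003101100200170103038004204100810470046074002208601141250006)
  (.split 7 (-707) 707 (.leaf 100048015000701700470200017021002303200340400002041001204300310890100)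
  (.split 22 642 766 (.leaf 30138010016201100950170068020021402307690440146047028105301590920394)
  (.split 14 (-798) (-601) (.split 41 927 374 (.split 1 (-951) (-309)
  (.leaf 300520100029011024801402080200033029007903201520530072056021010000101010142)
  (.split 15 788 (-615) (.leaf 30078010005501101880130001023005702900380320120035019105600821040221)
  (.split 15 (-788) 615 (.leaf 301180100083011026301404730170364020013102602450380217) subtree2)))
  (.leaf 20032005003200700970090109011006502400780260077))
  (.leaf 30180009013401106940140132020008902302790260442047019005000030950513))))))
  (.leaf 301250070048009017001106700320250035025404101440500236068027907900680800320)))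
  (.leaf 3004100900010110153026024302902670440002062000107400040950262)))
  (.leaf 1100170140017019000302000400220003023004408700020890037)))
  (.leaf 1100170130003014004001600030170044059001708100020830037)))))
  (.leaf 30214009012701105610140134017011002002660380172048004005005490710302))) (.split 11 629 777
  (.leaf 200100050010010002001110100120082014015901701810660094)
  (.leaf 2011400501140111343012021901401450170383029009306803100860052))) (.split 6 559 829
  (.leaf 30350007025501102140120294014238701700480200190042021204408980650102)
  (.leaf 3019500900600110289012009501407680190050020008704201180440500)))
  (.leaf 30023009000601100430200011023002202600170360006038006405000070590030)))

def subtree4 : Cert :=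
  .split 1 (-956) 292 (.split 1 325 945 (.split 60 707 (-707)
  (.leaf 30029010001201100290140029017005202600360300006032004605900290770014)
  (.split 8 (-669) (-743)
  (.leaf 30016011003901400200170011020003802900260330004035002506200113120005)
  (.split 63 (-707) (-707) (.split 1 642 (-766)
  (.leaf 302900060032011019502000060230300026035403503140410443059005806804250860046)
  (.split 8 978 207 (.leaf 30057006005701000560110286026010902901210440087062001107101330890015)
  (.split 26 927 374 (.split 3 (-965) (-258)
  (.leaf 30019006001901000200110067014001802000600320038048000405000300770038) (.split 7 629 777
  (.leaf 30043010007001100510140073020006602300870380069051000905300680800160) (.split 9 (-920) 390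
  (.split 4 788 615 (.split 25 (-743) 669 (.split 2 (-788) 615
  (.leaf 301380060024010008101102880140201023030002601930290096035023006300300650216)
  (.split 5 (-798) (-601) (.split 3 951 309
  (.leaf 30025006002501000320110278017014902000760290085035005207100380890005) (.split 10 798 (-601)
  (.leaf 300970060016010005901102150140236020032102301400320210038009907200210740152)
  (.split 1 829 559 (.split 3 (-838) (-544) (.split 5 (-891) 453 (.split 3 891 (-453)
  (.split 145 (-87) (-996)
  (.leaf 301200060004011007501405060170459020000203801540470229053009808700260890188)
  (.split 0 104 (-994) (.split 10 (-573) 819 (.split 14 484 874 (.split 1 (-484) 874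
  (.leaf 3016801000740111404020087403200060350007065000509900371010263) (.split 3 52 (-998)
  (.split 8 (-874) (-484)
  (.leaf 301510100101011024701410780170883020050103207220350013071015610500331070237)
  (.split 191 (-484) 874
  (.leaf 30272011010401414270172695020158602308990380053044037707400191100746) (.split 0 (-587) 809
  (.leaf 301230111283017000902014390230717026040603805870410533077012711101411130327)
  (.leaf 3004700900450180022020006302302740260155038010204100941110042))))
  (.leaf 30033009007501401910170108029002103502730380300068018010200071040051)))
  (.leaf 3011000900450110554017057302900040320004062000309600240980172))
  (.leaf 300730090027011010901402700200132023011502600700290076053022909300160950114))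
  (.leaf 30009009002702300930250001026010504100110500017056006409000020920014)))
  (.leaf 90030011036001701260500097)) (.leaf 90031011034901701440470096))
  (.leaf 30088009007201106880140327026036302901090380163044014507800190800138))
  (.leaf 30101009008101108110140448020027502601250350186041016907500220770158))))
  (.leaf 30037009002801101610140157017004602000870260069032006406600080680058)))
  (.leaf 300490060019009002401101870140061017003902002280230051032006106200750800010))
  (.leaf 30055009004001102140170111020009302300620290111057001205900860860044))
  (.leaf 90031011024002000960230068))))
  (.leaf 30033006003300700300090121012002801400110280048045000704700520740108))))
  (.leaf 30029009001201100290200029023005203200360360006038004606500290830014))))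
  (.leaf 3005500600550090030011085002700120290086))
  (.leaf 30075006007500901640110699014012502003640260115044001505301670710196)

def subtree5 : Cert :=
  .split 39 559 829 (.split 4 (-707) 707 (.split 22 258 965 (.split 14 (-544) 838
  (.leaf 40057011011201400810160034017013002000080500029062007007100291220036)
  (.leaf 401490050014007001401103780140329016009701703730490007050021006202375880014))
  (.leaf 420020042004004200500420090029011078101300250140096)) (.split 2 453 891
  (.split 16 (-615) 788
  (.leaf 30140004004600701290100182011095001301030140132017017602000990530129056024305901520650176)
  (.split 24 469 882
  (.leaf 30165006011501000050110528014035501601560170031020020802300020560046059028706200541250066)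
  (.split 16 (-544) 838
  (.leaf 30182004002700601570110464014073901701770190061020007702301040260001059002306500271280033)
  (.leaf 400260090006011002901400920170026020006202300220710006)))) (.split 23 342 939
  (.split 20 974 224 (.leaf 4001601000520110150013004301700160230003065008012501012240002)
  (.split 71 829 (-559) (.split 183 927 374
  (.leaf 3008100800190100561011150102001770230087026107503509300580018062007506800881310160)
  (.split 20 (-874) 484 (.split 209 (-788) 615 (.split 0 (-241) 970 (.split 3 515 857
  (.leaf 2000600600060110030014001502000020320044071002507400250760004077000508000031430004)
  (.split 0 (-190) 981
  (.leaf 62005013500700270110246017003202301760320050035032007401370770065080010508300211460089)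
  (.split 201 0 1000 (.split 0 707 707 (.split 6 (-529) 848
  (.leaf 10042003007200501250070192010010101120500140143020010305300510860066089019709200784050047)
  (.split 3 (-422) 906
  (.leaf 570050204007004501000630110765014037704401110470361086012709201531580141)
  (.split 0 (-927) 374 (.split 28 (-544) 838 (.split 51 (-656) 754 (.split 163 17 (-999)
  (.leaf 301200050084011005001300100140495017039102001160260346029008705600270590188062002310100161070111)
  (.leaf 30207005014501101170140840017067302002000260331029015005602470590354062004010101961070016))
  (.leaf 302830050198006005800700100111117014092001702730230815026020605302860560728059005509802071040244))
  (.leaf 5012200700590110278014016902003720230127050007005301080560034091000909200051640088))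
  (.leaf 30224009010001103390170451020023205003080530062059000909202060930060095020409802431610297))))
  (.leaf 50060007002700900250110060029007803800360410094043000804400460790027086003315200455640004))
  (.leaf 30039011004102600960350010038006604100230440055080003608100030830070086004214900672660041))))
  (.leaf 2009100600140110369017008302000240290155030010403200050350041038001104401470710048074007407702981400363))
  (.split 21 788 (-615)
  (.leaf 900302470040171005003201107710140399017056302600830290699032019103503000440285074041414006892600009)
  (.split 1 (-838) 544
  (.leaf 2002200600080111807014059502000500230014033010003500040380025041005304701290740009077004414302142630016)
  (.leaf 3008300400160060027011035301408540200162032010503300970350026038010404100760470196077014414303072630029))))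
  (.split 3 857 515 (.split 8 819 573 (.leaf 110063014012501500290170203)
  (.leaf 220030022006002200700220090144028008813800141400166)) (.leaf 90027011020801200740350043))))
  (.leaf 3006900401170080017009011001400360170202023008705900640620120065007506801421280183)))
  (.split 1 (-325) 945 (.leaf 400360090003011004501200130140198)
  (.leaf 900130110124012004101400612240035))))) (.leaf 20003002000600200070060009003701101792550040)

def subtree6 : Cert :=
  .split 7 207 (-978) (.split 13 (-743) 669
  (.leaf 1000200110534017038502303590260015029032803501001040092) (.split 13 (-743) 669
  (.leaf 10074010005001102590140356020038502603590290015032032803801001070092) (.split 4 743 669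
  (.split 47 (-309) 951 (.leaf 30080010006501103270140093018003702000970230112026002703201981160094)
  (.split 15 669 743
  (.leaf 100140030012010008201400910170046023026402800090290012035007915100541520015)
  (.split 221 669 743 (.leaf 10003003002901000320230001026001202900030410092044001105000441550038)
  (.split 0 309 951 (.split 8 743 (-669)
  (.leaf 10154010007501117810140043023001702603310290488032073904407110470071050068112502731610027)
  (.split 12 309 951 (.split 39 978 207 (.split 17 (-951) (-309)
  (.leaf 1000330110217013002901401450200167) (.split 8 951 309
  (.leaf 1000310110519016002601701480410122) (.split 15 (-669) 743 (.split 8 309 951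
  (.split 14 (-207) (-978)
  (.leaf 10014010003401700870250010026015003000020320219050011305300670710061) (.split 57 951 309
  (.leaf 10059010007901101080140175017003002001720230080029038703503790470123053027205603810740326)
  (.split 237 743 669 (.split 34 309 (-951)
  (.leaf 1000100200070030004010002601100250140034017004902000160230024029001403500390380076041001408000121580030)
  (.split 28 (-669) (-743)
  (.leaf 5001501000250140011017001802600350290025032004003500100410022044004006200240830020)
  (.split 211 (-207) 978 (.split 39 (-951) 309 (.split 26 (-669) 743 (.split 18 (-669) 743
  (.split 54 978 207 (.split 3 (-743) 669
  (.leaf 5011201000510110104014013001702130200341038023304101690440100047052205000650590238062031908001590830505)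
  (.split 7 669 (-743) (.split 7 (-309) (-951) (.split 7 207 978
  (.leaf 5000501000310170024020009802301070260063029008305000350560068062000506500320680018071008608900440920168)
  (.split 11 951 309
  (.leaf 10002901100460120011014003902300340260037029002203200770530012059006406500250680062071000207401120920015)
  (.near [(0, 0, 0), (1, 0, 0), (7, 0, -1), (2, 0, 0), (4, 0, 0), (5, 0, 0), (3, 0, 0), (6, 0, 0)]
  [19, 18, 27, 20, 3, 21, 17, 16, 2, 14, 22, 7, 6, 15, 5, 13, 4, 28, 0, 1])))
  (.leaf 3000900900200110011017005202000270230060026001604700330530050062006006800120710003086004208700010890035))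
  (.leaf 500200090018014003801700360200027023002805000880530014056001606200130650049068000308300360860056)))
  (.leaf 10008009003401300010140078017017503500270380065044011205000200530108059019607700520800122))
  (.leaf 90072011005701404780320224035004403801990410426047018305004100530029056074107400910770597))
  (.leaf 3006400900380112604029012003200520380674044009304703320530871065007907101240740675))
  (.leaf 900190110095023005316700716840004))
  (.leaf 5000100900310120002017000202000400230082032002803800040470015086000816400506810007))))
  (.leaf 50022009001001100200200033023007602600370350034056002205800050590039))))
  (.leaf 600250090028011012701400730170003023007902600280290130047007405000320680112))
  (.leaf 100580090033011112601400370170034023015302603750440062047027805000600650256))))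
  (.leaf 101180060094009015001401790170619032000403500140380568041003105006970560523))
  (.leaf 100680060067009006501110350140350029000203200030350327047017605303011280073)))
  (.leaf 20030003000900500300090123020011302300640260268029056903505500410550047026812201691250129)))))
  (.leaf 10149009010401108210170717023077602907220320031035066004102021100186))))
  (.leaf 30016009004901300040170079023004103200991010079136000113700141430018)

def subtree7 : Cert :=
  .split 87 913 (-406) (.split 10 275 (-961) (.split 2 (-829) (-559) (.leaf 8006701001210170110)
  (.split 19 (-224) 974 (.split 39 587 809
  (.leaf 100070100005011006901300230140051065004209800341010033109000511000035820002)
  (.leaf 100720060039011021301300530140434020002506500820980066101005211000135820003))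
  (.split 18 (-898) 438 (.split 33 (-601) 798 (.split 31 (-891) (-453)
  (.leaf 10072007007201000050110204013007001403940190037020009206801191130103)
  (.leaf 10128007008601101780130124014070201900660200163068014211301234260042)) (.split 9 69 997
  (.split 4 121 (-992) (.split 35 615 (-788) (.split 57 (-656) 754
  (.leaf 1000020110144014015402500140260072029008008000031130002) (.split 6 (-484) 874
  (.leaf 600890100135011050801402380160113017015002302380260079029006513701701490076)
  (.split 46 241 970
  (.leaf 1000100240030010007000101100490130005014023601702330200268029004803200951400027)
  (.leaf 3000100190030030006000800700010110333014025801702220200321029002303201131400013))))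
  (.split 7 (-438) (-898) (.leaf 1200300120060019007004301000940120025014016202302000770180)
  (.split 35 (-754) (-656) (.split 46 207 978 (.split 8 (-325) 945
  (.leaf 101150100141011105801402460170200020015003200220350005089021012201716060008)
  (.split 1 656 754 (.split 40 (-544) 838
  (.leaf 30018011007101300560140013023003102900360380072127001814900262000080)
  (.leaf 900020110090013004703800841270040128001414900032000005)) (.split 62 (-731) 681
  (.split 46 965 258 (.split 10 (-788) 615
  (.leaf 3400300340060034010005001103780130149016003201702530190039)
  (.leaf 100460060055011034001300680140250017036602000840230273035017204701670980134))
  (.split 7 891 (-453) subtree6 (.leaf 90036011040202900890980089))) (.split 10 (-743) 669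
  (.leaf 10016006001700700020100004011033301404410170102020022702600490320201) (.split 7 788 (-615)
  (.leaf 10080011054001403860150005017063402001290230355032006504400681550033)
  (.leaf 100650090025011042501403130150037017047202001710230288029007103200850440013))))))
  (.split 8 (-615) 788 (.leaf 1008400600840100037011015701200180140795)
  (.leaf 10022006003600700140111133012004501402580230268035026008600821940162)))
  (.split 59 (-656) 754 (.leaf 10035010000401102570120063014007402000290290067032009703501431400038)
  (.leaf 110440012008901401840200141026006602900700320265035029514000741520007)))))
  (.split 9 (-719) 694
  (.leaf 220060013011006901200100140103020004002300240260020044000707400130770008116003314300241820049)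
  (.leaf 5000100600060110032012001801400240200019021000402300180250007026000607400250770028113000511600161820025)))
  (.split 34 529 (-848)
  (.leaf 103003010400600800111155012010901407170170273023035107100250740035107002814002351790206)
  (.leaf 6600300660060305007004301105720120243014198401706180230936071028114002961790311))))
  (.leaf 900900110686065025609802085820010))))
  (.leaf 1000500900290530049059000706500120920038110003712200031610012))
  (.leaf 50055009008502000420890054157003815800466600004)

def subtree8 : Cert :=
  .split 1 374 927 (.split 166 587 809
  (.leaf 30010003002000300500030110023014002002600300290029037000203800010590027)
  (.split 0 (-453) 891
  (.leaf 4022701102300170020029023203200290350242040003504102610500014062032910100061190008)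
  (.split 150 766 642 (.leaf 3002000600200100021011001201400240380042044002704700090650029)
  (.split 188 (-559) 829 (.leaf 100880050088010002701101300470104056007806801321070139)
  (.split 1 (-642) 766 subtree5 (.split 13 (-544) 838
  (.leaf 100490030052010002801105090120076041004504400480470054050005711300733630027)
  (.split 12 (-601) 798 (.split 18 913 406
  (.leaf 2000600300060050006006000601000300110036014001101700620180014020002404700041190064)
  (.split 13 (-838) (-544)
  (.leaf 2000500301390050005011027301401540170239020021702100920230165050007705901781220357)
  (.leaf 301130110197014013601702110200192021006802301220490010050005805901031220246)))
  (.leaf 300700090004011035001402430150072017012904300620440122047006505300761160098))))))))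
  (.split 34 707 707 (.split 167 707 707 (.split 141 (-754) (-656)
  (.leaf 6002601000490170023039001704100310440030047002106500021040038) (.split 3 (-52) 998
  (.leaf 100240060018010002101100800170038035004503800410410002046000504700050680062)
  (.split 128 (-559) 829 (.split 6 (-951) 309 (.split 4 866 500 (.split 6 882 469
  (.split 192 809 587 (.leaf 1000100200110030001006000101100290170034050002708300382420017)
  (.split 0 587 809 (.leaf 10013003000100600010110077020003405300280640009065000608600252450017)
  (.split 7 656 (-754) (.split 6 (-156) 987 (.split 2 87 996
  (.leaf 10010025003000100500170060001011005502600130290021062001707400280830021095004513400232540010)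
  (.split 209 0 1000 (.split 186 681 731
  (.leaf 10002006000300700010100002011002601400140170006038001206800330710022076000107700011010019)
  (.split 0 325 945
  (.leaf 10006006001901000080110069017002204100070470013071003807400280760008077000908300021040043)
  (.split 4 798 601 (.leaf 1001201000560440063073003908000470950013144000214600185580006)
  (.split 3 559 829 (.split 2 (-34) 999
  (.leaf 2100500210100023011009801400340440002047000305000050560004080005308300420860005092000610100011130067)
  (.split 122 559 (-829) subtree7 (.leaf 9003401100050170039047006808500040860045)))
  (.leaf 2001100600170090029011003501700190410003044000304500010470001083003208600330890018092000911000211490040)))))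
  (.leaf 10005005000101100170140017035003107400310760004077000313700406390001)))
  (.leaf 1003000500600080070003009006202300060260117035000905900950680005071001307400760920010))
  (.leaf 600020070002009005302000600590057064001006700220770042))))
  (.leaf 340030034006003400700340090091011008308000521190054))
  (.leaf 59006016400903350110126020046502900670490021050029605302600560178059005807701201160224))
  (.leaf 10089009010802300470410054052006805300454530002))
  (.leaf 1000900900410200048037000203800470430006050000505300390710007))))
  (.leaf 10006003901100400140012015001601700570340009035006403800520410038044001006200291010047))
  (.leaf 24003002400600240070071009005901101412400047))

def subtree9 : Cert :=
  .split 10 694 (-719) (.split 32 (-601) 798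
  (.leaf 200060030034005000601126770141610016000901700420190003020131203102260321618038002904400351280018)
  (.split 20 121 992 (.split 0 615 788
  (.leaf 3004400700100100035011017601702280200233023008202600890380183044003805000460650024)
  (.split 18 990 139 (.leaf 290030029006002901000540110134014012802000880260051)
  (.split 6 (-438) 898 (.leaf 100029011029801700740350051) (.split 6 (-615) 788
  (.leaf 300480070048010005201104330280026029008805800300590028) (.split 2 819 573
  (.split 17 (-544) 838
  (.leaf 30147004007000600320100050011026201402310170242020082502604920320971035088305200430530762)
  (.split 5 469 882
  (.leaf 30152007004401001000111242014033501701310200424023062003507660380802047010105606310620193)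
  (.split 9 438 (-898)
  (.leaf 1130030177007002601000710111824014073201701420200069023019503801010650082)
  (.split 9 (-819) 573 (.split 6 (-642) 766 (.split 2 615 (-788) (.split 4 292 956
  (.split 3 (-766) 642
  (.leaf 5003001101000610111353014006901715560201297032001303500020380012073012307408200800007)
  (.leaf 3500300350040022007006601137090140773017180602015050350132038013807301240740923))
  (.leaf 52003005200400470090041011108401407370170614020036007000190710328))
  (.leaf 4000600900150111671014083401705640230153059005806700300680513))
  (.leaf 59003010500900340111219014066701708070200381023010202600130290101064000206505330710059))
  (.leaf 1800300180040015007002700900430110314014013201702160230055026005702901030620087)))))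
  (.leaf 3007100700160090080011004701701660230175029012103100030320354050027105600610620073))))))
  (.leaf 34003003400400290090012011099901401150170179023014503501411310004)))
  (.split 9 (-743) (-669) (.split 20 669 743 (.leaf 10001501100020170065023003803500791130051)
  (.split 4 (-422) 906 (.leaf 400040100074011103301401510290132) (.split 35 (-719) 694
  (.split 1 (-669) 743 (.split 193 (-707) 707
  (.leaf 50014011001401300120140130017009402300350290068047008314300012450010) (.split 4 258 965
  (.split 207 0 1000 (.split 184 0 1000
  (.leaf 4000500600160110024014002401700870230027035004105400010560013062003906700100680009)
  (.split 14 (-325) 945 (.split 1 (-406) 913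
  (.leaf 360050103010002201102330230281029022303202780440140047010305300330620169068005807400700890022)
  (.split 1 34 999 (.split 199 927 374 (.split 2 (-945) 325 (.split 24 (-544) 838
  (.split 122 (-139) (-990)
  (.leaf 3003500600750110091014025101700930200387023003903801620440948047084305908640610003062008007711011730004)
  (.leaf 3005300601210090004011007401404070170153020003302300670380238044008104702930610005062013107700941730011))
  (.leaf 3000200400650050117006000301102970140179017028103502690411177044111405609030590207073000107410941700045))
  (.leaf 2004300600010090053011003201400730170067032011804101160500076053011605600030690020071004908300031670012))
  (.leaf 500240090016011001002900350350217038019105001310680159))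
  (.leaf 40044006008700901060110579025007902600560320105035047004704700500271063002507702691610048)))
  (.leaf 30026006000900900150200047029004704000020410045044002707100271550003)))
  (.leaf 20003011001701700240180004020006202300600340004035005614900035970007))
  (.leaf 400560090034011031801704140200205032020505002481460021))) (.split 1 (-469) 882
  (.split 6 819 (-573)
  (.leaf 20114003005800501140112332014815601500750173844035008805012520560050062006007700191460045)
  (.split 13 (-777) 629 (.leaf 2003900500390111521014071501726020180007020126003200671490032)
  (.leaf 200420050042009000501103830140450017216901800260200851)))
  (.leaf 9001101100990120006014032102900860470104)))
  (.leaf 9000201101860120015014010002301140410138))))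
  (.leaf 90033012000801400550200082032016807100051100057))

def subtree10 : Cert :=
  .split 8 788 615 (.split 186 (-906) 422 (.split 0 (-719) 694 (.split 24 (-529) 848
  (.split 14 241 970 (.split 34 927 374 (.split 29 (-656) 754
  (.leaf 10011701103620140439017024101902550201052023018303204120380251) (.split 9 615 (-788)
  (.leaf 100080011011801300920220077023022802500340260032)
  (.leaf 4007101102750140405017001702004590220205023102802601240350306)))
  (.leaf 60026007002600900510130021014003101600280170117020002002900220980045))
  (.leaf 400360090009011028901300160140160)) subtree8) (.split 176 788 615
  (.leaf 300200100055014012401900270200027053002408600255040007) (.split 25 (-898) 438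
  (.split 62 (-707) (-707) (.leaf 800300080040007010003601900010200096035004709800491160005)
  (.split 1 (-743) 669 (.split 10 (-469) 882
  (.leaf 1027400300310070180010025001138720170301026032503700190380018041016312200883540125) subtree9)
  (.split 3 (-681) 731 (.split 31 (-766) 642 (.split 38 927 374 (.split 12 766 (-642)
  (.split 3 139 990 (.split 11 945 325 (.split 2 469 (-882)
  (.leaf 58011165801402090170142025000202603270320596042000204405010560029062003507100070830045)
  (.leaf 17003001901105390140137017006002300780260387032065804200020440553056004306200520710010))
  (.leaf 9001301100580140033017014002200010230150029023103900010410194))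
  (.leaf 990110235014071301702170200528026063603600020380535050011905601440650027))
  (.leaf 200520050052011083901707610210010023088503300130350743))
  (.leaf 48003004800900650110039013002501401410180033020000403000330470043)) (.split 19 469 882
  (.leaf 10005003010000700400100050011017701423670201248032106003800870440104047053105001790590064)
  (.split 2 258 965
  (.leaf 45001000400300040070016011010001401170171728023115403509800410057050042705300240620018)
  (.leaf 131001000700300650110114014034101500010173195023179103515210470052050081105300710620018))))
  (.leaf 3003300600060090018038002604100250440024065002910400311220001)))) (.split 166 927 374
  (.leaf 1101960120042014012502601195100011)
  (.leaf 21400300590110174012024202006300260070032021103503150370041038021809801501160108)))))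
  (.split 59 (-829) (-559) (.leaf 400370100052014006902400180260023050002208900401070012)
  (.split 24 (-898) 438 (.split 1 (-587) (-809)
  (.leaf 21003002100400170100042020008103000050320054056004409500461130014) (.split 184 0 1000
  (.leaf 50030014011002202100270230026026000803200090330024037000203800090590019098001011600182180022)
  (.split 197 390 920 (.split 185 906 422 (.split 1 866 500
  (.leaf 1100720140085030001803200675730002) (.leaf 900240110110014008103000815730065))
  (.leaf 1100620140039027006402900216060032))
  (.leaf 20001011002201400200170001020004402400070380042101005211900015670010))))
  (.leaf 6003004100900560150055017000202000300260036027002603100070320037090000309200081100018))))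
  (.split 11 743 669 (.leaf 300010080068010010301200010140001017000102300010860164)
  (.split 2 (-656) (-754) (.split 1 258 965 (.split 6 544 (-838)
  (.leaf 300340070007008001701000150110137014007402100230230058035000804400060950052)
  (.split 28 (-529) 848 (.leaf 302650100244011288101404180200332024017902604541160187)
  (.split 2 642 766 (.split 2 766 (-642)
  (.leaf 300950080039011028301409730170271026009803000640320163)
  (.leaf 300240090004011008501402450170068026004203000160320041))
  (.leaf 301140110406012000401402220170180023014302700770290196))))
  (.leaf 3025800601290070129009007001119300180174020044302800970290070))
  (.leaf 30195008000900901190111200014032201703020230143029017303800330890080)))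

def subtree11 : Cert :=
  .split 15 656 754 (.split 3 (-104) (-994) (.split 14 (-529) 848 (.split 4 874 484
  (.leaf 2002900302280050029007020600800940110306013023901422280170267035011203802213200148)
  (.leaf 30029007002300800120090022011002801300260140241017003403500143210036)) (.split 7 874 (-484)
  (.split 7 325 945 (.split 10 (-484) 874
  (.leaf 30064010001901101380140068017006402000750230065026008407700630950014) (.split 3 (-874) 484
  (.split 8 970 241
  (.leaf 300310070018008000501000540110312014025901701610190093023003102900310320008)
  (.split 2 (-766) 642 (.split 7 (-469) (-882)
  (.leaf 30147007008601102820140324017012202004130260214029019103801000890018)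
  (.leaf 20030045007001801100950140095017003602001070260074029003003800230890015))
  (.leaf 303870070223008006001109360140482017102902200030230762026038803203910350103)))
  (.leaf 100030100009000701102510140116017023102001000260101029008103500740800061)))
  (.split 3 (-469) (-882) (.split 3 (-874) 484 (.split 8 874 484 (.split 107 927 374
  (.split 14 (-891) 453
  (.leaf 630030273007003601102230140179017025002004940230524026097902903550380167)
  (.leaf 300020070001008000100900230110223014010401700810230003024000102600090290002))
  (.leaf 3300200200030035005002000900390140003017008702000670230286026004503500210530002))
  (.leaf 300250070011008000400900190110024014002101700480180007020011402300320320010))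
  (.leaf 130020002003003000500020110047014005701701670200039029001803500110470014))
  (.leaf 4100300410090012011009701200140140239)))
  (.leaf 1200300120070024008000100900410110010014002801700700200031))) (.split 101 707 707
  (.split 15 (-927) 374 (.split 2 358 (-933) (.split 8 342 939 (.split 2 (-743) 669
  (.leaf 22003013400701120100057011036801401600160018017027603500710470091) (.split 6 913 406
  (.leaf 900030164010005201101780140452017035101900220200337038004705000600830222)
  (.leaf 1070030456007007501104200141136017088201900610200939038022105002820830348)))
  (.leaf 3600300360090013011019501300050140073)) (.split 10 (-874) 484 (.split 6 (-981) (-190)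
  (.split 29 981 190 (.leaf 100179013017901901060200139)
  (.leaf 6011000701100110043013018101900250200081)) subtree10) (.split 7 874 484 (.split 4 920 390
  (.leaf 700040110187014015101500470170316)
  (.leaf 1700200170050017011029601402290150087017043202300300440039))
  (.leaf 1101700120082014014902300893300035)))) (.split 26 927 374
  (.leaf 110097012002401400730230048) (.leaf 1100560120059014003502300462160036)))
  (.leaf 170020017003001700500170060017009007902900530560059))) (.split 4 275 961
  (.split 7 (-453) 891 (.leaf 30042007002701000120110099014001401500370170167020000702600230680014)
  (.split 4 933 358 (.leaf 200440050044008005801000620110101014010301701450180077)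
  (.split 6 615 (-788) (.leaf 30387008026501102650140454017040102005640210442023064403800463240264)
  (.split 3 601 798 (.leaf 30055011017601401060170064020005702400590260073029005107700243270030)
  (.leaf 300660070001011027601300060140119017007702000680240051026000102900540770016)))))
  (.leaf 20036005003600700180090013011031401200100140044))

def subtree12 : Cert :=
  .split 123 0 1000 (.split 1 (-945) 325 (.split 56 544 (-838) (.split 30 309 951 (.split 0 809 587
  (.leaf 80063010009301100160530151) (.split 4 707 707 (.split 4 (-615) 788 (.split 2 515 857
  (.leaf 30252011064001404100170121025007502603880500213059012506202080800027)
  (.leaf 302190090014011108801403560170105025006502603370500185059010806200380800084))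
  (.leaf 30076008000400900010110147014009701702000220023023011704700730590010))
  (.leaf 300250080020009001001100250140055019000702000390560048)))
  (.leaf 180020018003001800500180090014011027501300050140028)) (.split 30 829 559
  (.leaf 80061010008801100210500146) (.split 5 (-766) (-642) (.leaf 80071010007001100950170084)
  (.split 4 515 857 (.split 61 (-559) (-829) subtree11 (.split 3 258 965 (.split 13 (-707) 707
  (.leaf 3006301000130110187014008401500190170093020004003200513150034) (.split 7 (-515) 857
  (.leaf 30357010011301106970140468017034601801090200529065036006803340860191) (.split 1 (-990) 139
  (.leaf 30058011009401400790200125021001802300860260049068001207100210890002)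
  (.leaf 900380110215068003808900352130012))))
  (.leaf 180020018003001800500180090012011033101200050140026))) (.split 1 615 (-788)
  (.leaf 300780070014008004501100530120022014013002001070230009047001105600110590113)
  (.split 62 (-927) (-374)
  (.leaf 30022006000100700010110038013000501400410150006017003602300320620034)
  (.leaf 301450080032011010301401620150040017024102302180620229))))))) (.split 1 974 224
  (.split 95 981 190 (.leaf 1101810130001014015301500090170097)
  (.leaf 450110051014018401500570170070)) (.leaf 700090110046012005101400592960036)))
  (.split 28 882 469 (.leaf 80055010011804300290440166) (.split 1 (-707) 707 (.split 1 777 629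
  (.leaf 80067010010001100230500159) (.split 58 707 (-707)
  (.leaf 30044008003901000180110044014005601700620530093) (.split 6 (-573) (-819)
  (.leaf 30060008010301101110140070017007702000850560127) (.split 0 669 (-743)
  (.leaf 30028008002501000020110021020003602300400590060) (.split 62 (-681) (-731)
  (.leaf 30039008000101100460140096023005002600550620082)
  (.leaf 30028008002500900110110030023003602600400620060)))))) (.split 57 484 (-874)
  (.leaf 30033008004501000090110059014006405001081220014) (.split 5 (-788) (-615)
  (.leaf 80070010007201101080140080) (.split 2 (-970) 241 (.split 61 (-707) (-707)
  (.split 2 615 (-788) (.split 0 (-656) (-754) (.split 5 587 (-809)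
  (.leaf 3001900800330100010011012602300720680079) (.leaf 3006600801620110056014032602302510680278))
  (.leaf 300190080034011001402000720650080)) (.leaf 3001501100660130016014002101700570620063))
  (.leaf 3003400800590090014011003401401270590141))
  (.leaf 2012800501280080338009004201113620560806))))))

def subtree13 : Cert :=
  .split 4 390 920 (.split 122 (-358) 933 (.split 20 484 874 (.leaf 100017011007801300891220032)
  (.leaf 400210110118013002201400791220015)) (.split 117 (-358) 933 (.split 21 484 874
  (.leaf 100017011007801300891070032)
  (.leaf 3001200500120060012007001201101340130025014009010700174500012)) (.split 16 (-342) 939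
  (.leaf 100350040035007007101000190110292) (.split 85 920 (-390) (.split 6 707 707
  (.split 24 866 500 (.leaf 80058010008101100350320137) (.split 2 (-939) (-342)
  (.leaf 80063010007401101091700063) subtree1)) (.split 0 484 874 (.split 151 0 1000 (.split 0 374 927
  (.leaf 2000301100210160008017007503500210380007056001609200031580016)
  (.leaf 50130011043201600430170527026001002901010350147038032209200411580031))
  (.split 3 (-927) (-374) (.leaf 80064010007701100951730064) (.split 27 891 453
  (.leaf 80054010011904000310410166) (.split 0 777 629 (.leaf 80067010010001100210440159)
  (.split 10 939 342 (.split 9 (-898) 438 (.split 0 (-500) 866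
  (.leaf 3002600600260110347016006101700750200063031004804100050530111)
  (.leaf 3003600600360110222016012001702060200044031010904100170530265))
  (.leaf 200340050034011025801300470140284028010702901150500269)) (.split 8 (-927) 374 subtree3
  (.leaf 900420110052012000101400620680035))))))) (.split 2 (-927) (-374)
  (.leaf 80064010007701100951700064) (.split 1 (-87) 996 (.split 27 848 529
  (.leaf 80059010008501100280410142) (.split 9 681 731 (.split 7 (-615) 788
  (.leaf 30035007003501000340110180018000802000550230019) (.split 2 207 978 subtree4
  (.leaf 3003500600350090008011033402100080230055))) (.split 3 275 (-961)
  (.leaf 3004100800130110023012004501401760180009020006418200132970041) (.split 58 (-838) (-544)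
  (.leaf 30028011003601400340150015017006002000200210006023004405000230680010)
  (.leaf 300350090019011002301500380170149021000802300543000035))))) subtree12))))
  (.split 51 (-838) (-544) (.split 12 927 374 (.leaf 110095014006601500180170074)
  (.leaf 6005800700580090055011007801400510150072)) (.leaf 90009011008101200820470032))))))
  (.leaf 1005500500550090034011039026401104800055)

def subtree14 : Cert :=
  .split 113 (-374) 927 (.split 84 0 1000 (.split 13 406 913 (.split 6 (-898) 438 (.split 57 882 469
  (.leaf 70016010011701400980170010080000927300332780045) (.split 95 (-559) 829
  (.leaf 300390070010008001801000700170032020008302900272760029) (.split 1 (-241) 970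
  (.split 6 766 642 (.split 1 406 913 (.split 5 (-484) 874
  (.leaf 301060100055011038301701840230142035011804100752880031) (.split 4 (-933) 358
  (.leaf 300560110117014012601701240190008020007804400392910009)
  (.leaf 300170110086014004301600030170036020004803800120440012)))
  (.leaf 20097005009700900270110433)) (.split 5 719 694 (.split 5 (-669) 743
  (.leaf 300220080027011010601300390150007017001504100152880043) (.leaf 80070011023001300810140020))
  (.leaf 302970070297009034701111000120089014020103802102850297)))
  (.leaf 20017005001700800340110030020000802300370260029))))
  (.leaf 20007005000700700220080056009002801101000140061))
  (.leaf 1012800501280070256009008201108644830128)) (.split 5 (-707) 707 (.split 20 374 927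
  (.leaf 20020005002000700410080029010003201401000170029)
  (.leaf 1001700200130040001005002800800120110160014004001700124860015))
  (.leaf 20025005002500800600110085014004205300170710032))) (.split 90 681 731 (.split 13 707 707
  (.split 6 (-642) 766 (.split 22 (-374) 927
  (.leaf 20011003001100500110080008011013501400350160026020001402300110260008)
  (.leaf 3005800800760110056014032401601800200071023005602600412730058))
  (.leaf 80083011010801300730140044)) (.split 21 (-829) 559 (.split 88 (-927) 374
  (.leaf 1700200170030017005001700600170100070011004201500360170087) (.split 4 (-719) 694
  (.leaf 300360070036010002101100610180030020007102900252760036) (.split 4 920 390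
  (.leaf 700100100029011009401400690170128) (.split 1 (-978) 207 (.split 4 (-469) 882
  (.split 12 (-707) 707 (.leaf 30071007001001000250110061013002001401510170118020016802601530410050)
  (.split 7 559 829 (.split 4 898 438
  (.leaf 3000700700070100020011042501400210200022023006003200710470005)
  (.leaf 30277007019200802070110743014203601702920200356023044703204700470196))
  (.leaf 3002000700200090009011005201700120200033023004702900390440014)))
  (.leaf 3006100700610090014011008701401020170146023002402901380380043))
  (.leaf 1100200110050011009004101101370140108020009802400140260033)))))
  (.leaf 300110070061009004201400800160015017001702000250230008))) (.split 0 (-707) 707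
  (.split 6 (-707) 707 (.leaf 30035007003500800010100028011007101400250230025) (.split 15 707 707
  (.leaf 30016007001600800390110054014005501700120260011)
  (.leaf 30026007002600800190110062014002701700190260018))) (.split 6 (-707) 707
  (.split 0 (-374) 927 (.leaf 100360040036007007201000210110267) (.split 2 (-978) 207
  (.leaf 200180030067005001800801240110248014056502900472760121)
  (.leaf 100320050032007006400800630090007011029801402874920032)))
  (.leaf 30010008005001100710120010014006002300072700010))))

def subtree15 : Cert :=
  .split 0 (-866) (-500) (.split 43 374 (-927) (.leaf 8005801102670130115)
  (.leaf 80065011007101300620140069)) (.split 0 (-707) (-707) (.split 113 (-707) 707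
  (.split 4 (-374) 927 (.leaf 1003600500360070072010002101102674800036) (.split 13 292 956
  (.split 86 707 707 (.split 48 707 (-707) (.split 2 809 587 (.leaf 80071010007101100500230076)
  (.split 96 (-559) 829 (.leaf 30033010005701100020140126016001401700332790033) (.split 5 (-829) 559
  (.split 7 390 920 (.split 4 515 (-857) (.split 1 838 544 (.split 4 (-882) 469 (.split 65 422 906
  (.leaf 3001701100200140051016000501700290190005020002802600502970006)
  (.leaf 30035008002401100190130027014003501900100200058026001803200660380025))
  (.leaf 30059008006700902190110859014092901701580230121029012103507150460032))
  (.leaf 3010700800810090072011010401300300140177020022002602192910213))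
  (.leaf 80111009001901106290400157))
  (.leaf 3004200800610100010011003201400860200086023010103700422850084))
  (.leaf 1200300120070024008005600900580110028017013002000290340012))))
  (.leaf 800710090030011007102500440260193)) (.split 0 (-838) 544
  (.leaf 20017005001700800350110030017003202000380770005)
  (.leaf 200170050017007000300800370110067018001102000290770037)))
  (.leaf 10035005003500700350090016011034226700354830035))) (.split 90 707 707 (.split 46 669 (-743)
  (.split 14 390 920 (.split 22 (-707) 707 (.split 0 (-292) 956
  (.leaf 1200200200030012005002000800080100013011027502000300280011) (.split 2 515 857
  (.leaf 200190030128005001900800800110163014056102303110260219029021903101132840015)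
  (.leaf 30038007001100800240090035011047002300930260065029006503100342840046)))
  (.leaf 30143008008901103750140288017034602003750210077023029802501262730066))
  (.leaf 30014007000400800090090006011006701400340170024020002402200122750017))
  (.leaf 80072011009701900700200109)) (.split 0 (-707) 707 (.split 47 707 (-707)
  (.split 7 (-707) 707 (.leaf 300310080010010002501100610140033017002202600462730031)
  (.split 16 681 731 (.leaf 300140080043011004501400470170034020001002800142760014)
  (.leaf 30035009002701100750160014017003502000252760035)))
  (.leaf 800710090030011007102200440230193)) (.split 6 (-374) 927
  (.leaf 1003600500360100021011026727000724860036) (.split 48 629 (-777) (.split 1 (-573) 819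
  (.split 1 500 (-866) (.leaf 300470080033010001301100810140304023004710100332790047)
  (.leaf 300340080100011085001402230230034031010710100242790034))
  (.leaf 300200080086011009201400480180011020009502800152760020))
  (.leaf 80257011033002502560260366)))))) subtree14)

def subtree16 : Cert :=
  .split 22 920 (-390) (.split 4 (-694) (-719) (.split 6 777 629 (.split 3 615 788
  (.leaf 100340100036011009301401650160003017011302901743300034) (.split 11 (-788) 615
  (.leaf 10004201401240160009017005502001420230008032009405000075490033) (.split 7 469 882
  (.split 5 882 (-469) (.split 5 (-891) (-453)
  (.leaf 1003200200180070068010009301112350140373017021102601300590108077004411000492090031)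
  (.split 4 406 913 (.split 4 (-829) 559
  (.leaf 20022007004401001270140621017066502001190230563032032506500775640083) (.split 7 829 559
  (.split 19 (-469) 882 (.leaf 10114010010101128660140480017002802302460890115221006535401145700036)
  (.split 3 559 829 (.leaf 10060005000300700630100075011120901708210200048026042103205950920038)
  (.split 1 (-719) 694 (.split 8 629 777
  (.leaf 100014011073101401240170575023067102600980320308035009809800922300010)
  (.split 7 (-788) (-615) (.split 6 (-956) 292 (.split 0 (-848) 529
  (.leaf 20081010017801713010201112023033202606460320321044026237201625880070) (.split 4 (-601) 798
  (.split 12 798 (-601)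
  (.leaf 1000700200010070009010001001101160140075017010102301160260179032014903802161130034)
  (.split 153 469 882 (.split 124 (-374) 927 (.split 184 707 707
  (.leaf 1001600300060050008007000301100430140033017003502000420230066025001603202230350343046000804701271220037)
  (.leaf 100350110052014004301700450200263023041302602560321236035124604109620471339095002912202062540069))
  (.leaf 100200020008004002000500080110101019000402000390300121)) (.split 0 (-325) 945
  (.leaf 3002100900020110025016000301701120200158029008203201273840041) (.split 179 (-707) 707
  (.split 0 (-207) 978 (.split 133 (-374) 927
  (.leaf 3000301100130140012026000702900090380111041012005301011280008260000539300036090003)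
  (.leaf 300170110027024001002601360290281032000903801560470020053002212800033930017))
  (.leaf 1100820170024023018302602880290128035010403800190500136125006425700153900019395002248000256060010))
  (.leaf 3000501100250140018020006802301070260024032002004000090410001122001325400013920017)))))
  (.leaf 1001900200020070023009002301101190140187020030202304670290216035037004701301100063)))
  (.leaf 90007011008901404270170418020002202304730290551041001710400762360025))
  (.leaf 90020011113201408410170044020095202611100290162038003510101522330017)))
  (.leaf 1000700200040070015009009201100100200042029027203000800320038035034709500102270007))))
  (.leaf 1015800701580090156011180101703120200640023055202609060680356)))
  (.leaf 90061011042801400420170187023010502901310620121080010721200115610002)))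
  (.leaf 1001200200070070026009020501112310140081023005002606240560041074001710701782060012))
  (.leaf 10180002009400703680090238011552601400250200744023049407102512030162))))
  (.leaf 1002600700260090018011006201400630170062020000402600910440053)) (.split 9 (-798) 601
  (.leaf 10002010001201100610140100020007902400020260102032004932700025430016) (.split 17 (-809) 587
  (.leaf 10002010001201100600170100023007902700030290102035004933000025820016) (.split 8 891 453
  (.leaf 1001620112395014038201703735490002)
  (.leaf 100160080014011078401401810170177020088102606980320897050003933300165490001)))))
  (.leaf 90044011004702300650890035)

def subtree17 : Cert :=
  .split 13 719 694 (.split 6 (-500) 866 (.split 159 (-707) 707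
  (.leaf 10014005001300800210110013014015701600430200009023000916100092730026)
  (.split 50 (-743) (-669) (.leaf 200700050070007021001000620110054017058001901120350110)
  (.split 7 927 374 (.split 5 438 898
  (.leaf 100470070047008005201100320140209017008702000700230390025011749800295390049)
  (.leaf 80024011020301402030170090020008002302540250078041001449800335390056))
  (.leaf 1002600700260090018011001001400290190007020011702200140380014)))) (.split 0 (-601) 798
  (.leaf 80072009001801108230160103) (.leaf 80083011010401600750170044))) (.split 158 0 1000
  (.split 1 390 920 (.split 50 (-866) (-500)
  (.leaf 1000200200030050003006000900700200110072014010601700240230024026002403500170440012)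
  (.split 4 848 529 (.leaf 100420100030014001901500200170132020001602900162790042)
  (.leaf 110046014004001500020170101020002802900285180007)))
  (.leaf 2004800500480070048009003001103392730096)) (.split 49 (-920) (-390) (.split 8 (-707) 707
  (.split 8 866 (-500) (.leaf 2006600500660070198010010301106430140142016020902301360470040)
  (.split 12 559 829 (.leaf 1005100400510070102011025801404920170110019011602005140260105)
  (.leaf 15003001500600150070046009004101101240170043)))
  (.leaf 1001300400130070026009002601100070130014014004502000760350033)) (.split 1 (-707) 707
  (.leaf 10036005003600700720100015011003601800460200104) (.split 9 (-406) 913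
  (.leaf 101280040128007025601000820110864) (.split 108 484 874
  (.leaf 1005200700520100037011000501700520200040024000102601220380037) (.split 9 559 829
  (.split 177 (-500) 866 (.leaf 100340100032011003702600370300029032006628800345040034)
  (.split 1 965 258 (.leaf 1000250110112014004102600505070006) (.split 4 (-838) 544
  (.split 2 (-694) 719 (.split 1 (-681) 731
  (.leaf 1011201103180130068014033203800950440189059008230001125160112)
  (.leaf 10108007010800800120110362013006601403210380092044022105900795160108)) (.split 11 906 422
  (.leaf 10057010004702000350380015042001004400883000057) (.split 104 (-559) 829
  (.leaf 3001000500170070017010003701100260230021038001704100200470086303001046500144820012)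
  (.split 4 920 390 (.leaf 1000530110396020010104101035220001) (.split 11 (-358) (-933)
  (.split 14 390 920 (.split 4 342 939 (.split 0 743 669
  (.leaf 1015800800410100122017054101900130200128023018603501103180158) subtree16)
  (.leaf 90188011044301701030200147029022203204100500305074021418200565310035))
  (.leaf 10049009002001102300140044015000401700580470034179002431200495280014)) (.split 14 656 754
  (.leaf 102010080181011301301200380140523017036702602240290490047022831202015280002)
  (.leaf 100350090026011008101200070140092015002801700253120035)))))))
  (.leaf 10001000300300100040003007002600800160090066032003203801180510028))))
  (.leaf 1008400700840090026011012501700480230072027001602901780440062)))))))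

def subtree18 : Cert :=
  .split 7 (-406) (-913) (.split 9 (-190) 981
  (.leaf 5000400700040100026011008801400520230039026001602900660350036) (.split 4 777 629
  (.split 6 (-777) 629 (.leaf 100051011026301701640200093023015702601380350029) (.split 10 819 573
  (.split 3 (-342) 939 (.leaf 10006501102920140180017011202001640260122041013316700075340004)
  (.split 2 (-898) 438 (.split 8 (-438) 898
  (.leaf 10157002000500701670100130011333901402920200235026021403201711730079) (.split 12 406 913
  (.split 3 (-573) 819 (.split 10 891 (-453) (.split 10 (-694) (-719) (.split 9 829 559
  (.split 8 927 374 (.split 6 (-642) 766 (.split 2 956 292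
  (.leaf 50001011008301400900170065023004902600470290084032000503801213480001) (.split 6 (-453) 891
  (.leaf 10012901104910140545020038902604410350280041014720000265670041) (.split 5 (-809) (-587)
  (.split 7 809 (-587)
  (.leaf 2000100700020100046011093501400310171122020028502306430260203041001304708215730020)
  (.split 4 (-573) 819 (.split 4 906 422
  (.leaf 10001007000101000260111043014070901704180200735023077803203920530545) (.split 14 (-838) 544
  (.leaf 100010070001010004301100640170297020017502303080260326) (.split 149 707 707
  (.split 120 927 374 (.split 174 707 707 (.leaf 11004601400870170046033003503500193750007)
  (.leaf 11003001400560170030019000602000450260094029005503200380330018224000537500053980012))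
  (.leaf 20027005000301100250180021020006602302540260150029015005600331760009)) (.split 0 (-374) 927
  (.leaf 3002100700420090005011001602301810260107027000302901170560044) (.split 181 (-707) 707
  (.split 0 (-207) 978 (.split 129 (-374) 927
  (.leaf 3000500700050110022014002102700120290187032004303400070350051036000403801920650073)
  (.leaf 1000500300180070023011002902600410290031032034303300090350165038020205000115970002))
  (.leaf 110116017003402309570261273029114603206760351220038081304705500620002383003139300274680010))
  (.leaf 10001003000401100210140016021000902400010260135029008803200590340004044002922400013800015))))))
  (.leaf 2001700700340090087011164501411840170603020108102303290290235044024805008675760008)))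
  (.leaf 90020011010001404250170107020024202300760320126038000404403095700008))))
  (.leaf 2001000700190090031011049201402540170170020021402304670260514029017503508195610001))
  (.leaf 500370090018011038501401250170150020046902306600260122029036703207813420037))
  (.leaf 900610110488014019501702040200329023003802601595550076))
  (.leaf 90068011032001200800170358020004102301740260519032009803800895520002))
  (.leaf 90050011021504100781010036))
  (.leaf 1008700901180111013017053402009440260012032001104105473300087))
  (.leaf 900470110175018001302001231760036))) (.leaf 900560110258017014702301345370003)))
  (.leaf 500260090048011007501401150200205023005002602260290199038006331500265670049)))
  (.split 6 (-754) 656 (.leaf 100016011010601700530200030023005102600450350009)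
  (.leaf 11003101201000140265017033002001870230316026027803500595280151))))
  (.leaf 80028009002801100980170078020003602300840260030032003303800685550004)

def subtree19 : Cert :=
  .split 6 (-469) 882 (.split 4 766 642
  (.leaf 1000100800670100106014000101700010200139044000128500015010001)
  (.leaf 10177011043801300440140333017017802002730440232053003128501775010177))
  (.split 110 (-292) 956 (.leaf 100114025006202600881550033) (.split 5 777 629
  (.leaf 80068010010701100030230140) (.split 4 (-731) 681 (.split 50 (-374) (-927)
  (.leaf 20020007004001000370110011014004801700420230051026000805300740620039) (.split 14 961 (-275)
  (.split 6 (-629) (-777) (.split 6 (-681) 731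
  (.leaf 10116010006801103290140140017025202302780260242071003230301165190116) (.split 0 (-984) 173
  (.split 6 438 898 (.split 6 (-629) 777 (.split 19 920 390
  (.leaf 10057010024201103940140203017013502005100270052032025031500575360248) (.split 3 (-945) 325
  (.split 6 (-906) (-422)
  (.leaf 20043007008601000780110151014001802001530230102035024003801020890076) (.split 8 913 (-406)
  (.split 2 (-788) 615 (.leaf 10043010003201101690140098017008302601540290102095000232700435430043)
  (.split 5 (-469) 882
  (.leaf 100820100063011075401400520170047026000204701920980014330008254600795510001)
  (.split 7 484 874 (.split 3 766 (-642)
  (.leaf 10287002010301000960115358014117001727290201383032018833604925570114) (.split 3 (-920) 390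
  (.split 0 (-838) 544 (.leaf 1007400700740100059011049301702300200222023051803201455580074)
  (.split 9 777 629 (.split 3 882 (-469) (.split 1 829 559 (.split 174 453 891 (.split 145 0 1000
  (.split 116 (-374) 927
  (.leaf 2001200300490070012011013601401260170141023019303805840410167050009407702381280016)
  (.leaf 200110110023021000202301140290138039001004101191640008)) (.split 170 (-707) 707
  (.split 0 (-469) 882 (.split 124 0 1000
  (.leaf 11002001400170200005026008902900150350037044007204700250560034083003737100055820017)
  (.leaf 11001702900960340003035012004500050470117054000208300105510017))
  (.leaf 9000401100940170020026012403100030320146042000604401440800016131000136800205840020))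
  (.leaf 10007003000701100170140012023010002900900380022041016505000100770012360001436500125810012)))
  (.leaf 10011009002701100290140042017032002304050350475071007509200551220005354001136900225750007))
  (.leaf 10021009001701101340140089018000102000080290063032014704100383510021))
  (.leaf 20005007001000900900110591017000602600140290034038022106500121160076))
  (.leaf 1002100900100110017014000402000650230062026014503500413450021)))
  (.leaf 10160007016000900870112271014049801704800201120035010505602325600064)))
  (.leaf 1025100700730090232011845401701590200143029000505005911010043333017854902435540003))))
  (.leaf 90086012004201401480920035)))
  (.leaf 10063009003001103640140041017022402001490320093035010531800635390025)))
  (.leaf 2005200700690090081011033801403550170171024000402602153120035))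
  (.leaf 2003500700100090027011051501400110230014026008507700063090060))
  (.leaf 900390110167018005102300950740036)))
  (.leaf 1002200900380110052012002002000520230045029004130000225160022))
  (.leaf 20005007001000900400110143014001201700120200010026000102900540650047)))
  (.leaf 2014600702920080041009033401104650141032020027502300460500403))))

def subtree20 : Cert :=
  .split 5 (-629) 777 (.leaf 1002201000110110058014007401700430200043026002205000032820022)
  (.split 0 (-984) 173 (.split 6 (-719) (-694) (.split 0 (-927) (-374)
  (.leaf 1001200400120070024010002801100690230060026008102900350590023) (.split 2 (-766) 642
  (.leaf 1004001000280110135014010202601350290073032007906200032940040) (.split 7 642 766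
  (.leaf 100130100031011001901400600290127030000303200582970013) (.split 180 544 838
  (.split 168 927 374 (.split 3 (-956) 292 (.split 9 (-601) 798 (.split 11 891 (-453)
  (.split 4 754 656 (.split 3 (-829) 559
  (.leaf 1007401000590110398017021202003380320283038016808600103180074) (.split 1 819 573
  (.split 8 453 891 (.split 2 (-898) 438 (.split 5 809 (-587)
  (.leaf 10222010008101115270142465017108302002840321050038043533002225460020) (.split 7 (-484) 874
  (.leaf 102070100180011297101409580171111023001104100161010128185012833302075490001)
  (.split 3 559 829 (.leaf 100130100024011005001403030150001017016802001903360013)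
  (.split 116 (-406) 913 (.leaf 3003900700110100097013003201408160160011019001905700243390029)
  (.split 6 956 292 (.leaf 10039005002001000190110077017048302003940230223026047905000753420059)
  (.split 0 920 390
  (.leaf 101270100027011158502012600231028026075002913700530443065031411300223450127)
  (.split 166 438 898 (.split 3 (-838) 544
  (.leaf 3002000700200100040014002402400080260457031001703200572030014) (.split 144 0 1000
  (.split 115 (-374) 927
  (.leaf 1003300300370070022011010601400980200109032174203501300380217077009112500192090094)
  (.leaf 20024005002400700120110097030010903400070350070)) (.split 0 (-707) 707
  (.leaf 3002201000090110022032021603501760370004038011407700423570044) (.split 176 (-707) 707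
  (.split 123 0 1000 (.split 1 (-207) 978
  (.leaf 50006007000601000040110014014001703000010320098040000304102340860054)
  (.leaf 100040050010011004401400120200034030001404101070440245047013904800010500049074001708600213710024))
  (.leaf 1100170390005041016204300060440142046000604701595300017))
  (.leaf 1000600500030110021014002102400060360001038018504101130420003044009006800343650015)))))
  (.leaf 9004601100080140010020005302400240260369029037203204270560005116000120000015640001))))))))
  (.leaf 900320110232017008403501285430006))
  (.leaf 1007100200020070073009006101118630140023017020702301660320035092004217600423240002))
  (.leaf 10056009004401103050200161023025603502140410127089000832100565370056)))
  (.leaf 10023009001501100540130004014005901701030290086035004131500235310023))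
  (.leaf 2000400500040070012009005001101480140028026002303201600800048))
  (.leaf 101220020002007012500901460110562014049401700130200006023109104403741610027))
  (.leaf 900310110266014010901700495220014))
  (.leaf 10061005003700900250110015017032702001080350229036000503801053030098))
  (.leaf 101070070015011006901404390200187032030803502620410058068005030000915160049)))))
  (.leaf 100210090029014005902000700210008023002202600412880021))
  (.leaf 900390110167018005105300361370036))

def subtree21 : Cert :=
  .split 159 0 1000 (.split 130 (-669) 743 (.split 167 0 1000 (.split 96 87 996 subtree17
  (.split 5 (-358) 933 (.leaf 1003600500360100020011027926700714830036) (.split 14 309 951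
  (.split 159 (-374) 927 (.split 3 (-669) 743 (.split 51 (-891) (-453) (.split 12 927 374
  (.split 5 (-819) 573 (.split 5 587 809
  (.leaf 200100050010007003001000660140149019003502000830470076) (.split 12 848 (-529)
  (.leaf 2003300500330070099010004701104290140215017008502000550220113) (.split 2 (-544) 838
  (.leaf 2001300500130070039010001801101570140254023036002500710260226)
  (.leaf 1001100400110070022011004201401390170077023016702500390260123))))
  (.leaf 2000700500070070020009001001100400160019017004402600300440040))
  (.leaf 1600100130030016004001300600160070074009013402300530260054)) (.split 2 342 939
  (.split 170 (-978) 207 (.split 5 809 587 (.leaf 80071010007201100490320076) (.split 1 (-629) 777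
  (.leaf 800030100038011002401400740230044025003802600180350003) (.split 10 500 866
  (.split 9 (-819) 573 (.split 15 920 (-390) subtree18 (.leaf 90087030001503200740680034))
  (.leaf 1000300100070020008003100900600110022020012902900280540022))
  (.leaf 9000601100420170032026002102800080290025038001305300175100024))))
  (.leaf 900450110153014004403500415010012))
  (.leaf 80051009003101101130140054017012102300520260086041004214900305340061)))
  (.split 3 (-819) 573 (.split 169 (-681) 731 (.split 53 (-743) (-669)
  (.leaf 100080100006011004901300240170053020002504400272850008)
  (.leaf 100120080011011002301400360170079020003804400252850012))
  (.leaf 102770090007011043001408880150287017014304104522820277))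
  (.leaf 800670090021011009601200300140061)))
  (.leaf 80040011004301700430180016020002414000284890001))
  (.leaf 100350040035007007000900170110324)))) (.split 12 927 374 (.leaf 80064010007701100950260064)
  (.split 5 (-292) 956 (.leaf 100350040035007007001000160110342) (.split 1 325 945
  (.split 94 (-422) 906 (.leaf 300240070024010005101100060140080032002404100171610017)
  (.split 2 (-882) 469 (.split 51 (-390) (-920) subtree19
  (.leaf 1003300800290090040011004501400600200051029003327900334950033))
  (.leaf 20013007002600800360090033011006301700790260006035001314600061640003)))
  (.leaf 2003500500350070035009001801103082700071)))))
  (.leaf 2003500500350090074015007301700060200020026003506500352630020)) (.split 2 (-707) 707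
  (.split 11 390 920 (.split 2 (-374) 927 (.split 47 (-927) (-374)
  (.leaf 10016007000201100680130003014003801700110200034026003603500152670014)
  (.leaf 1002301100190130004014005701700130190003020005002600172670023)) (.split 47 (-515) (-857)
  (.split 158 0 1000 (.leaf 10020011001401500040170012020001402300450290020038000114000142700020)
  (.split 3 838 544 (.leaf 80065010011902400230260141) (.split 7 965 (-258) (.split 6 (-374) 927
  (.leaf 1003600500360100021011026727900724950036) subtree20)
  (.leaf 1000300400030070006009002301101050140007020003802900080440030))))
  (.leaf 10033009005901100060140053019002802000672670033)))
  (.leaf 100480040048009003001103392610096)) (.split 11 707 707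
  (.leaf 800710100029011007101200290140071) (.split 2 (-920) 390 (.split 47 (-707) (-707)
  (.split 1 (-777) 629 (.leaf 10030004000200700320100013011002201400470200113021003202300150290047)
  (.leaf 1010900701090110396014003002003940210109023005502901641220052))
  (.leaf 1002300700140110059014002501701100180046024003202600142670009))
  (.leaf 1001700700170090012011005001400820150034021001702300171160024))))

def certificate : Cert :=
  .split 43 0 1000 (.split 80 707 707 (.split 3 559 829 (.split 2 374 927 (.split 1 882 469
  (.split 19 (-374) 927 (.split 2 829 559 (.split 5 927 374
  (.leaf 100080020004004000800500040110194014013001700370200155) (.split 3 970 241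
  (.leaf 18002007900300180050079006001801000520110156014015101700900200688)
  (.leaf 3200200250030032005002500600320110397014027201701620200297)))
  (.leaf 1004100200470040041005004700900050110117014055001700860260057))
  (.leaf 20017005001700700100110041014008101700410230054))
  (.leaf 36003003600600360070107009016401102131530071)) (.leaf 200360050036009002101102672580108))
  (.leaf 20003002000600200070060009003701101791470040)) (.split 51 (-866) 500 (.split 88 913 406
  (.split 2 (-838) 544 (.leaf 2900200110050011011004501300580230016029001608600163560007)
  (.split 115 (-707) 707 (.leaf 70060011009801400570160076)
  (.leaf 1101570140204016007001702042640013))) (.split 1 (-390) 920 (.split 0 406 913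
  (.split 14 (-438) 898 (.leaf 100530040053007001101000010110315014003402600440350031)
  (.split 8 707 707 (.split 6 (-374) 927 (.split 2 (-961) 275
  (.leaf 2000200200030020005002000600200100085011003701200290140093)
  (.leaf 20027005002701102540120019014006201700990380070))
  (.leaf 90010004002003300300090040004005003300600090110109014014301701120200111))
  (.leaf 24003002400600240070071009005901101411620047))) (.leaf 20097005009700900030110364))
  subtree13)) (.split 11 (-374) 927 (.leaf 100140040014007004800800280100045011019401200552570028)
  (.split 3 857 515 (.split 1 (-829) 559 (.leaf 7005301100960140071018007306800092630001)
  (.leaf 1500300150060015007006301101460140159018012202000420680082))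
  (.leaf 70034008002001100540140009015009206500282600018))))) (.split 77 707 (-707) subtree15 subtree21)

theorem check_certificate : check certificate start = true := by decide +kernel

theorem Normalized.isOptimal {d : ℝ} {x y : ℕ → ℝ} (hd : d * (1 + √3) = 1)
    (h : Normalized d x y) : IsOptimal d (fun i : Fin 8 => x i) (fun i : Fin 8 => y i) :=
  (nearOptimal_of_check h certificate start (holds_start h) check_certificate).isOptimal hd

/-! ### Reduction to normalized configurations -/

theorem IsOptimal.congr {ι κ : Type*} {d : ℝ} {x y : ι → ℝ} {x' y' : κ → ℝ}
    (h : IsOptimal d x y) (s₁ s₂ : ℝ)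
    (hs : ∀ k, ∃ i, ∃ m n : ℤ, x' k = x i + s₁ + m ∧ y' k = y i + s₂ + n) :
    IsOptimal d x' y' := by
  obtain ⟨t₁, t₂, h⟩ := h
  refine ⟨t₁ + s₁, t₂ + s₂, fun k => ?_⟩
  obtain ⟨i, m', n', hx', hy'⟩ := hs k
  obtain ⟨a, ha, m, n, hx, hy⟩ := h i
  refine ⟨a, ha, m + m', n + n', ?_, ?_⟩ <;> push_cast <;> linarith

theorem ideal_neg_fst (a : ℕ) (ha : a < 8) : ∃ b < 8, ∃ m n : ℤ,
    -ideal₁ a = ideal₁ b + (1 + √3) * m ∧ ideal₂ a = ideal₂ b + (1 + √3) * n := by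
  refine ⟨[1, 0, 2, 3, 5, 4, 6, 7].getD a 0, by interval_cases a <;> simp,
    [0, 0, -1, -1, -1, -1, 0, 0].getD a 0, 0, ?_⟩
  interval_cases a <;> norm_num [ideal₁, ideal₂] <;> ring

theorem ideal_neg_snd (a : ℕ) (ha : a < 8) : ∃ b < 8, ∃ m n : ℤ,
    ideal₁ a = ideal₁ b + (1 + √3) * m ∧ -ideal₂ a = ideal₂ b + (1 + √3) * n := by
  refine ⟨[0, 1, 3, 2, 4, 5, 7, 6].getD a 0, by interval_cases a <;> simp,
    0, [0, 0, 0, 0, -1, -1, -1, -1].getD a 0, ?_⟩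
  interval_cases a <;> norm_num [ideal₁, ideal₂] <;> ring

theorem IsOptimal.neg_fst {ι : Type*} {d : ℝ} (hd : d * (1 + √3) = 1) {x y : ι → ℝ}
    (h : IsOptimal d x y) : IsOptimal d (-x) y := by
  obtain ⟨t₁, t₂, h⟩ := h
  refine ⟨-t₁, t₂, fun i => ?_⟩
  obtain ⟨a, ha, m, n, hx, hy⟩ := h i
  obtain ⟨b, hb, m', n', hx', hy'⟩ := ideal_neg_fst a ha
  refine ⟨b, hb, m' - m, n' + n, ?_, ?_⟩ <;> push_cast
  · rw [Pi.neg_apply]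
    linear_combination d * hx' - hx + m' * hd
  · linear_combination d * hy' + hy + n' * hd

theorem IsOptimal.neg_snd {ι : Type*} {d : ℝ} (hd : d * (1 + √3) = 1) {x y : ι → ℝ}
    (h : IsOptimal d x y) : IsOptimal d x (-y) := by
  obtain ⟨t₁, t₂, h⟩ := h
  refine ⟨t₁, -t₂, fun i => ?_⟩
  obtain ⟨a, ha, m, n, hx, hy⟩ := h i
  obtain ⟨b, hb, m', n', hx', hy'⟩ := ideal_neg_snd a ha
  refine ⟨b, hb, m' + m, n' - n, ?_, ?_⟩ <;> push_cast
  · linear_combination d * hx' + hx + m' * hd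
  · rw [Pi.neg_apply]
    linear_combination d * hy' - hy + n' * hd

/-- All lifts of eight points of the torus to the cylinder, numbered by height. -/
structure Chain (d : ℝ) (X Y : ℤ → ℝ) : Prop where
  x_add : ∀ i, X (i + 8) = X i
  y_add : ∀ i, Y (i + 8) = Y i + 1
  mono : Monotone Y
  sep : ∀ i j, ¬ 8 ∣ j - i → ∀ m n : ℤ,
    d ^ 2 ≤ (X j - X i - m) ^ 2 + (Y j - Y i - n) ^ 2

namespace Chain

variable {d : ℝ} {X Y : ℤ → ℝ}

theorem add_mul (h : Chain d X Y) (i k : ℤ) : X (i + 8 * k) = X i ∧ Y (i + 8 * k) = Y i + k := by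
  induction k using Int.induction_on with
  | zero => simp
  | succ k ih =>
    have h1 := h.x_add (i + 8 * k)
    have h2 := h.y_add (i + 8 * k)
    rw [show i + 8 * ((k : ℤ) + 1) = i + 8 * k + 8 by ring, h1, h2, ih.1, ih.2]
    push_cast
    exact ⟨rfl, by ring⟩
  | pred k ih =>
    have h1 := h.x_add (i + 8 * (-(k : ℤ) - 1))
    have h2 := h.y_add (i + 8 * (-(k : ℤ) - 1))
    rw [show i + 8 * (-(k : ℤ) - 1) + 8 = i + 8 * (-k) by ring] at h1 h2
    rw [← h1, ih.1]
    rw [ih.2] at h2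
    push_cast at h2 ⊢
    exact ⟨rfl, by linarith⟩

theorem shift (h : Chain d X Y) (c : ℤ) :
    Chain d (fun i => X (i + c)) (fun i => Y (i + c)) where
  x_add i := by rw [add_right_comm, h.x_add]
  y_add i := by rw [add_right_comm, h.y_add]
  mono i j hij := h.mono (by gcongr)
  sep i j hij := h.sep _ _ (by simpa using hij)

theorem reverse (h : Chain d X Y) (c : ℤ) :
    Chain d (fun i => X (c - i)) (fun i => -Y (c - i)) where
  x_add i := by rw [← h.x_add, show c - (i + 8) + 8 = c - i by ring]
  y_add i := by rw [show c - i = c - (i + 8) + 8 by ring, h.y_add]; ring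
  mono i j hij := neg_le_neg (h.mono (by gcongr))
  sep i j hij m n := by
    have := h.sep (c - i) (c - j) (by omega) m (-n)
    push_cast at this
    linarith

theorem neg_fst (h : Chain d X Y) : Chain d (-X) Y where
  x_add i := by simp [h.x_add]
  y_add := h.y_add
  mono := h.mono
  sep i j hij m n := by
    have := h.sep i j hij (-m) n
    push_cast at this
    simp only [Pi.neg_apply]
    linarith

theorem isOptimal_of_half (h : Chain d X Y) (hd : d * (1 + √3) = 1)
    (hw : ∀ k, Y 3 - Y 0 ≤ Y (k + 3) - Y k) (hr : Y 1 - Y 0 ≤ Y 3 - Y 2)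
    (hx : Int.fract (X 1 - X 0) ≤ 1 / 2) : IsOptimal d X Y := by
  have hY : ∀ i : ℕ, i < 8 → Y 0 ≤ Y i ∧ Y i ≤ Y 0 + 1 := fun i hi =>
    ⟨h.mono (by omega), (h.mono (by omega : (i : ℤ) ≤ 0 + 8)).trans (h.y_add 0).le⟩
  have hN : Normalized d (fun i => if i < 8 then Int.fract (X i - X 0) else 0)
      (fun i => if i < 8 then Y i - Y 0 else 0) := by
    refine ⟨?_, by simp, by simp, fun i => ?_, fun i => ?_, fun i => ?_, fun i => ?_,
      fun i j hij hj => ?_, fun k hk => ?_, ?_, ?_, fun i j hij hj m n => ?_⟩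
    · nlinarith [sqrt_three_bounds]
    · split_ifs; exacts [Int.fract_nonneg _, le_rfl]
    · split_ifs; exacts [(Int.fract_lt_one _).le, zero_le_one]
    · split_ifs with hi
      · linarith [hY i hi]
      · rfl
    · split_ifs with hi
      · linarith [hY i hi]
      · exact zero_le_one
    · rw [if_pos hj, if_pos (hij.trans hj)]
      linarith [h.mono (by omega : (i : ℤ) ≤ j)]
    · have h1 := hw (k + 1)
      have h2 := (h.add_mul (((k + 4) % 8 : ℕ) : ℤ) ((k + 4) / 8 : ℕ)).2
      rw [show (((k + 4) % 8 : ℕ) : ℤ) + 8 * ((k + 4) / 8 : ℕ) = k + 1 + 3 by omega] at h2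
      rw [if_pos (by omega), if_pos (by omega), if_pos (by omega)]
      rw [Int.cast_natCast] at h2
      rw [h2] at h1
      rw [Nat.cast_succ, Nat.cast_ofNat]
      linarith
    · norm_num
      linarith
    · norm_num at hx ⊢
      exact hx
    · rw [if_pos hj, if_pos (hij.trans hj), if_pos hj, if_pos (hij.trans hj)]
      have h1 := h.sep i j (by omega) (⌊X j - X 0⌋ - ⌊X i - X 0⌋ + m) n
      have h2 := Int.floor_add_fract (X j - X 0)
      have h3 := Int.floor_add_fract (X i - X 0)
      push_cast at h1
      convert h1 using 3 <;> linarith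
  refine (hN.isOptimal hd).congr (X 0) (Y 0) fun k => ?_
  have hk : (((k % 8).toNat : ℕ) : ℤ) = k % 8 := Int.toNat_of_nonneg (by omega)
  have h8 : (k % 8).toNat < 8 := by omega
  refine ⟨⟨(k % 8).toNat, h8⟩, ⌊X (k % 8) - X 0⌋, k / 8, ?_⟩
  have h1 := h.add_mul (k % 8) (k / 8)
  rw [Int.emod_add_mul_ediv] at h1
  have h2 := Int.floor_add_fract (X (k % 8) - X 0)
  simp only [h8, if_true, hk]
  constructor <;> linarith

theorem isOptimal_of_reflection (h : Chain d X Y) (hd : d * (1 + √3) = 1)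
    (hw : ∀ k, Y 3 - Y 0 ≤ Y (k + 3) - Y k) (hr : Y 1 - Y 0 ≤ Y 3 - Y 2) : IsOptimal d X Y := by
  rcases le_or_gt (Int.fract (X 1 - X 0)) (1 / 2) with hx | hx
  · exact h.isOptimal_of_half hd hw hr hx
  · have hx' : Int.fract ((-X) 1 - (-X) 0) ≤ 1 / 2 := by
      have e : (-X) 1 - (-X) 0 = -(X 1 - X 0) := by simp only [Pi.neg_apply]; ring
      rw [e, Int.fract_neg (by linarith)]
      linarith
    have := (h.neg_fst.isOptimal_of_half hd hw hr hx').neg_fst hd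
    rwa [neg_neg] at this

theorem isOptimal_of_window (h : Chain d X Y) (hd : d * (1 + √3) = 1)
    (hw : ∀ k, Y 3 - Y 0 ≤ Y (k + 3) - Y k) : IsOptimal d X Y := by
  rcases le_total (Y 1 - Y 0) (Y 3 - Y 2) with hr | hr
  · exact h.isOptimal_of_reflection hd hw hr
  · refine (((h.reverse 3).isOptimal_of_reflection hd (fun k => ?_) ?_).neg_snd hd).congr 0 0
      fun k => ⟨3 - k, 0, 0, ?_⟩
    · have := hw (-k)
      rw [show 3 - (k + 3) = -k by ring, show (3 : ℤ) - k = -k + 3 by ring]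
      norm_num
      linarith
    · norm_num
      linarith
    · simp

theorem isOptimal (h : Chain d X Y) (hd : d * (1 + √3) = 1) : IsOptimal d X Y := by
  obtain ⟨c, -, hc⟩ := (Finset.Ico (0 : ℤ) 8).exists_min_image (fun k => Y (k + 3) - Y k)
    ⟨0, by simp⟩
  refine ((h.shift c).isOptimal_of_window hd fun k => ?_).congr 0 0 fun k => ⟨k - c, 0, 0, ?_⟩
  · have h1 := hc ((k + c) % 8) (by simp; omega)
    have h2 := (h.add_mul ((k + c) % 8) ((k + c) / 8)).2
    have h3 := (h.add_mul ((k + c) % 8 + 3) ((k + c) / 8)).2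
    rw [add_right_comm, Int.emod_add_mul_ediv] at h3
    rw [Int.emod_add_mul_ediv] at h2
    rw [add_right_comm k 3 c, h2, h3, add_comm 3 c, zero_add]
    linarith
  · simp

end Chain

theorem isOptimal_of_separated {d : ℝ} (hd : d * (1 + √3) = 1) {x y : Fin 8 → ℝ}
    (h : ∀ i j, i ≠ j → ∀ m n : ℤ, d ^ 2 ≤ (x i - x j + m) ^ 2 + (y i - y j + n) ^ 2) :
    IsOptimal d x y := by
  set σ := Tuple.sort fun i => Int.fract (y i) with hσ
  have hmono : Monotone ((fun i => Int.fract (y i)) ∘ σ) := Tuple.monotone_sort _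
  let r : ℤ → Fin 8 := fun i => ⟨(i % 8).toNat, by omega⟩
  have hr : ∀ i : ℤ, r (i + 8) = r i := fun i => by simp [r]
  have hc : Chain d (fun i => x (σ (r i))) (fun i => Int.fract (y (σ (r i))) + (i / 8 : ℤ)) := by
    refine ⟨fun i => by simp only [hr], fun i => ?_, fun i j hij => ?_, fun i j hij m n => ?_⟩
    · simp only [hr]
      rw [show (i + 8) / 8 = i / 8 + 1 by omega]
      push_cast
      ring
    · rcases (Int.ediv_le_ediv (by norm_num) hij : i / 8 ≤ j / 8).eq_or_lt with h8 | h8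
      · rw [h8]
        gcongr
        refine hmono (?_ : r i ≤ r j)
        simp only [r, Fin.mk_le_mk]
        omega
      · have h1 := Int.fract_nonneg (y (σ (r j)))
        have h2 := Int.fract_lt_one (y (σ (r i)))
        have h3 : ((i / 8 : ℤ) : ℝ) + 1 ≤ (j / 8 : ℤ) := by exact_mod_cast h8
        linarith
    · have hne : σ (r j) ≠ σ (r i) := by
        rw [Ne, σ.injective.eq_iff]
        simp only [r, Fin.mk.injEq]
        omega
      have h1 := h _ _ hne (-m)
        (⌊y (σ (r i))⌋ - ⌊y (σ (r j))⌋ + j / 8 - i / 8 - n)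
      have h2 := Int.floor_add_fract (y (σ (r j)))
      have h3 := Int.floor_add_fract (y (σ (r i)))
      push_cast at h1
      convert h1 using 3
      · ring
      · linarith
  refine (hc.isOptimal hd).congr 0 0 fun k => ⟨(σ.symm k : ℕ), 0, ⌊y k⌋, ?_⟩
  have hk : r ((σ.symm k : ℕ) : ℤ) = σ.symm k := by
    apply Fin.ext
    simp only [r]
    omega
  have h8 : (((σ.symm k : ℕ) : ℤ) / 8) = 0 := by omega
  simp only [hk, h8, Equiv.apply_symm_apply]
  have := Int.floor_add_fract (y k)
  push_cast
  constructor <;> linarith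

/-- A separated configuration is a renumbered translate of the optimal arrangement. -/
theorem exists_equiv_of_separated {d : ℝ} (hd : d * (1 + √3) = 1) {x y : Fin 8 → ℝ}
    (h : ∀ i j, i ≠ j → ∀ m n : ℤ, d ^ 2 ≤ (x i - x j + m) ^ 2 + (y i - y j + n) ^ 2) :
    ∃ (t₁ t₂ : ℝ) (π : Equiv.Perm (Fin 8)), ∀ i, ∃ m n : ℤ,
      x i = d * ideal₁ (π i) + t₁ + m ∧ y i = d * ideal₂ (π i) + t₂ + n := by
  obtain ⟨t₁, t₂, H⟩ := isOptimal_of_separated hd h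
  choose π hπ m n hx hy using H
  have hinj : Function.Injective fun i => (⟨π i, hπ i⟩ : Fin 8) := by
    intro i j hij
    by_contra hne
    have hij' : π i = π j := congrArg Fin.val hij
    have h1 := h i j hne (m j - m i) (n j - n i)
    have h2 : d ≠ 0 := left_ne_zero_of_mul (hd ▸ one_ne_zero)
    have h3 := sq_pos_of_ne_zero h2
    rw [hx i, hx j, hy i, hy j, hij'] at h1
    push_cast at h1
    ring_nf at h1 h3
    linarith
  exact ⟨t₁, t₂, Equiv.ofBijective _ (Finite.injective_iff_bijective.1 hinj),
    fun i => ⟨m i, n i, hx i, hy i⟩⟩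

theorem sq_le_of_e2norm {d : ℝ} (hd : 0 ≤ d) {p : Fin 8 → ℝ × ℝ}
    (hp : ∀ i j : Fin 8, i ≠ j → ∀ m n : ℤ, e2norm (p i - p j + ((m : ℝ), (n : ℝ))) ≥ d)
    (i j : Fin 8) (hij : i ≠ j) (m n : ℤ) :
    d ^ 2 ≤ ((p i).1 - (p j).1 + m) ^ 2 + ((p i).2 - (p j).2 + n) ^ 2 := by
  have h := hp i j hij m n
  rw [e2norm, ge_iff_le, Real.le_sqrt hd (by positivity)] at h
  simpa using h

end TorusPacking

/-- The optimal 8-point arrangement on the square flat torus is unique up to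
isometry of the torus. -/
theorem eight_points_optimal_unique (p q : Fin 8 → ℝ × ℝ)
    (hp : ∀ i j : Fin 8, i ≠ j → ∀ m n : ℤ,
      e2norm (p i - p j + ((m : ℝ), (n : ℝ))) ≥ 1 / (1 + Real.sqrt 3))
    (hq : ∀ i j : Fin 8, i ≠ j → ∀ m n : ℤ,
      e2norm (q i - q j + ((m : ℝ), (n : ℝ))) ≥ 1 / (1 + Real.sqrt 3)) :
    ∃ Q : Matrix (Fin 2) (Fin 2) ℝ,
      Q * Q.transpose = 1 ∧ (∀ a b : Fin 2, ∃ z : ℤ, Q a b = (z : ℝ)) ∧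
      ∃ t : ℝ × ℝ, ∃ σ : Equiv.Perm (Fin 8),
        ∀ i : Fin 8, ∃ a b : ℤ,
          p i - (mulVec2 Q (q (σ i)) + t) = ((a : ℝ), (b : ℝ)) := by
  have hd : 1 / (1 + √3) * (1 + √3) = 1 := div_mul_cancel₀ _ (by positivity)
  have hd0 : 0 ≤ 1 / (1 + √3) := by positivity
  obtain ⟨s₁, s₂, π, hπ⟩ := TorusPacking.exists_equiv_of_separated hd
    (TorusPacking.sq_le_of_e2norm hd0 hp)
  obtain ⟨t₁, t₂, τ, hτ⟩ := TorusPacking.exists_equiv_of_separated hd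
    (TorusPacking.sq_le_of_e2norm hd0 hq)
  refine ⟨1, by simp, fun a b => ⟨if a = b then 1 else 0, by simp [Matrix.one_apply]⟩,
    (s₁ - t₁, s₂ - t₂), π.trans τ.symm, fun i => ?_⟩
  obtain ⟨m, n, hx, hy⟩ := hπ i
  obtain ⟨m', n', hx', hy'⟩ := hτ ((π.trans τ.symm) i)
  simp only [Equiv.trans_apply, Equiv.apply_symm_apply] at hx' hy'
  refine ⟨m - m', n - n', Prod.ext ?_ ?_⟩
  · simp [mulVec2, hx, hx']
    ring
  · simp [mulVec2, hy, hy']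
    ring
end

section
/- For every N ≥ 1 and every configuration of N points on the square flat torus, the minimal toroidal distance is at most 2/√(N·√12). Precisely: for every N ≥ 2 and every p : Fin N → ℝ × ℝ there exist i ≠ j and integers m, n with ‖p i − p j + (m, n)‖ ≤ 2/√(N·√12). -/
open MeasureTheory Set
open scoped Real ENNReal

lemma volume_triangle (s k : ℝ) (hs : 0 ≤ s) (hk : 0 ≤ k) :
    volume {z : ℂ | 0 < z.re ∧ z.re < s ∧ |z.im| < k * z.re} = ENNReal.ofReal (k * s ^ 2) := by
  have hpre : {z : ℂ | 0 < z.re ∧ z.re < s ∧ |z.im| < k * z.re} =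
      Complex.measurableEquivRealProd ⁻¹'
        regionBetween (fun x => -(k * x)) (fun x => k * x) (Ioo 0 s) := by
    ext z
    simp [regionBetween, abs_lt, and_assoc]
  rw [hpre, Complex.volume_preserving_equiv_real_prod.measure_preimage_equiv,
    Measure.volume_eq_prod, volume_regionBetween_eq_integral]
  · congr 1
    rw [← integral_Ioc_eq_integral_Ioo, ← intervalIntegral.integral_of_le hs]
    have : ((fun x => k * x) - fun x => -(k * x)) = fun x : ℝ => (2 * k) * x := by
      ext x; simp; ring
    rw [this, intervalIntegral.integral_const_mul, integral_id]
    ring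
  · exact ((continuous_const.mul continuous_id).neg.integrableOn_Icc (a := 0) (b := s)).mono_set
      Ioo_subset_Icc_self
  · exact ((continuous_const.mul continuous_id).integrableOn_Icc (a := 0) (b := s)).mono_set
      Ioo_subset_Icc_self
  · exact measurableSet_Ioo
  · intro x hx
    have := mul_nonneg hk hx.1.le
    linarith

lemma volume_circular_sector_le {R θ : ℝ} (hR : 0 ≤ R) (hθ : 0 ≤ θ) :
    volume {z : ℂ | ‖z‖ < R ∧ ‖z‖ * Real.cos θ < z.re} ≤ ENNReal.ofReal (R ^ 2 * θ) := by
  set S := {z : ℂ | ‖z‖ < R ∧ ‖z‖ * Real.cos θ < z.re}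
  have hS : MeasurableSet S := by
    refine (IsOpen.and (isOpen_lt ?_ ?_) (isOpen_lt ?_ ?_)).measurableSet <;> fun_prop
  rw [← lintegral_indicator_one hS, ← Complex.lintegral_comp_polarCoord_symm]
  calc ∫⁻ p in polarCoord.target,
        ENNReal.ofReal p.1 • S.indicator 1 (Complex.polarCoord.symm p)
      ≤ ∫⁻ p in polarCoord.target, (Ioo 0 R ×ˢ Ioo (-θ) θ).indicator
          (fun p : ℝ × ℝ => ENNReal.ofReal p.1) p := by
        refine setLIntegral_mono' polarCoord.open_target.measurableSet fun p hp => ?_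
        by_cases hpS : Complex.polarCoord.symm p ∈ S
        · obtain ⟨hr, hφ⟩ := hp
          have hr : 0 < p.1 := hr
          have hnorm : ‖Complex.polarCoord.symm p‖ = p.1 := by
            rw [Complex.norm_polarCoord_symm, abs_of_pos hr]
          have hre : (Complex.polarCoord.symm p).re = p.1 * Real.cos p.2 := by
            rw [Complex.polarCoord_symm_apply]
            simp [Complex.cos_ofReal_re]
          have h1 : p.1 < R := hnorm ▸ hpS.1
          have h2 : p.1 * Real.cos θ < p.1 * Real.cos p.2 := by
            have := hpS.2
            rwa [hnorm, hre] at this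
          have h3 : Real.cos θ < Real.cos |p.2| := by
            rw [Real.cos_abs]; exact lt_of_mul_lt_mul_left h2 hr.le
          have h4 : |p.2| < θ := by
            by_contra! h
            exact absurd (Real.cos_le_cos_of_nonneg_of_le_pi hθ (abs_lt.2 hφ).le h) h3.not_ge
          have hmem : p ∈ Ioo 0 R ×ˢ Ioo (-θ) θ := ⟨⟨hr, h1⟩, abs_lt.1 h4⟩
          rw [indicator_of_mem hpS, indicator_of_mem hmem]
          simp
        · rw [indicator_of_notMem hpS]
          simp
    _ ≤ ∫⁻ p, (Ioo 0 R ×ˢ Ioo (-θ) θ).indicator (fun p : ℝ × ℝ => ENNReal.ofReal p.1) p :=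
        setLIntegral_le_lintegral _ _
    _ = ∫⁻ p in Ioo 0 R ×ˢ Ioo (-θ) θ, ENNReal.ofReal p.1 :=
        lintegral_indicator (measurableSet_Ioo.prod measurableSet_Ioo) _
    _ = (∫⁻ r in Ioo 0 R, ENNReal.ofReal r) * ∫⁻ _ in Ioo (-θ) θ, 1 := by
        rw [Measure.volume_eq_prod, ← Measure.prod_restrict, ← lintegral_prod_mul
          (by fun_prop) (by fun_prop)]
        simp
    _ = ENNReal.ofReal (R ^ 2 / 2) * ENNReal.ofReal (2 * θ) := by
        congr 1
        · rw [← ofReal_integral_eq_lintegral_ofReal]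
          · rw [← integral_Ioc_eq_integral_Ioo, ← intervalIntegral.integral_of_le hR, integral_id]
            congr 1; ring
          · exact (continuous_id.integrableOn_Icc (a := 0) (b := R)).mono_set Ioo_subset_Icc_self
          · exact (ae_restrict_iff' measurableSet_Ioo).2 (.of_forall fun x hx => hx.1.le)
        · rw [setLIntegral_one, Real.volume_Ioo]
          congr 1; ring
    _ = ENNReal.ofReal (R ^ 2 * θ) := by
        rw [← ENNReal.ofReal_mul (by positivity)]
        congr 1; ring

lemma mul_le_sin_mul_cos {θ : ℝ} (h0 : 0 ≤ θ) (h1 : θ ≤ π / 6) :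
    3 * √3 / (2 * π) * θ ≤ Real.sin θ * Real.cos θ := by
  have hpi := Real.pi_pos
  have ht : 6 * θ / π ≤ 1 := by rw [div_le_one hpi]; linarith
  have h := strictConcaveOn_sin_Icc.concaveOn.right (show (0 : ℝ) ∈ Icc 0 π from ⟨le_rfl, hpi.le⟩)
    (show π / 3 ∈ Icc 0 π from ⟨by positivity, by linarith⟩)
    (show 0 ≤ 1 - 6 * θ / π by linarith) (show 0 ≤ 6 * θ / π by positivity) (by ring)
  have h2 : (1 - 6 * θ / π) • (0 : ℝ) + (6 * θ / π) • (π / 3) = 2 * θ := by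
    simp; field_simp; ring
  rw [h2, Real.sin_two_mul, Real.sin_zero, Real.sin_pi_div_three] at h
  have h3 : 3 * √3 / (2 * π) * θ = (6 * θ / π * (√3 / 2)) / 2 := by field_simp; ring
  rw [h3]
  simp at h
  linarith

/-- The part of the disc of radius `R` about `0` seen from `0` within the arc that the bisector
of `0` and `q` cuts off from that disc. -/
def bisectorSector (R : ℝ) (q : ℂ) : Set ℂ :=
  {z | ‖z‖ < R ∧ ‖z‖ * ‖q‖ ^ 2 < 2 * R * (z * (starRingEnd ℂ) q).re}

lemma isOpen_bisectorSector (R : ℝ) (q : ℂ) : IsOpen (bisectorSector R q) := by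
  refine IsOpen.and (isOpen_lt ?_ ?_) (isOpen_lt ?_ ?_) <;> fun_prop

lemma norm_lt_norm_sub_iff (z q : ℂ) :
    ‖z‖ < ‖z - q‖ ↔ 2 * (z * (starRingEnd ℂ) q).re < ‖q‖ ^ 2 := by
  rw [← sq_lt_sq₀ (norm_nonneg _) (norm_nonneg _), Complex.sq_norm, Complex.sq_norm,
    Complex.sq_norm, Complex.normSq_sub]
  constructor <;> intro h <;> linarith

lemma bisectorSector_eq_empty {R : ℝ} {q : ℂ} (h : 2 * R ≤ ‖q‖) :
    bisectorSector R q = ∅ := by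
  refine eq_empty_of_forall_notMem fun z hz => ?_
  obtain ⟨h1, h2⟩ := hz
  have hR : 0 < R := (norm_nonneg z).trans_lt h1
  have h3 : (z * (starRingEnd ℂ) q).re ≤ ‖z‖ * ‖q‖ := by
    simpa using Complex.re_le_norm (z * (starRingEnd ℂ) q)
  have h4 : ‖z‖ * ‖q‖ * (2 * R) ≤ ‖z‖ * ‖q‖ * ‖q‖ := by gcongr
  nlinarith

lemma disjoint_bisectorSector {R : ℝ} {a b : ℂ} (ha : √3 * R ≤ ‖a‖) (hb : √3 * R ≤ ‖b‖)
    (hab : √3 * R ≤ ‖a - b‖) : Disjoint (bisectorSector R a) (bisectorSector R b) := by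
  rw [Set.disjoint_left]
  rintro z ⟨h1, h2⟩ ⟨-, h3⟩
  have hR : 0 < R := (norm_nonneg z).trans_lt h1
  have hz : 0 < ‖z‖ := by
    rw [norm_pos_iff]
    rintro rfl
    simp at h2
  have key : ∀ {c : ℂ}, √3 * R ≤ ‖c‖ → 3 * R ^ 2 ≤ c.re ^ 2 + c.im ^ 2 := fun {c} hc => by
    have := pow_le_pow_left₀ (by positivity) hc 2
    rw [mul_pow, Real.sq_sqrt (by norm_num), Complex.sq_norm, Complex.normSq_apply] at this
    linarith
  have ha := key ha
  have hb := key hb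
  have hab := key hab
  rw [Complex.sq_norm, Complex.normSq_apply] at h2 h3
  set y : ℂ := ((R / ‖z‖ : ℝ) : ℂ) * z with hy
  have hzy : z = ((‖z‖ / R : ℝ) : ℂ) * y := by
    rw [hy, ← mul_assoc, ← Complex.ofReal_mul]
    have : ‖z‖ / R * (R / ‖z‖) = 1 := by field_simp
    simp [this]
  have hy2 : y.re ^ 2 + y.im ^ 2 = R ^ 2 := by
    have : ‖y‖ ^ 2 = R ^ 2 := by
      rw [hy, norm_mul, Complex.norm_real, Real.norm_of_nonneg (by positivity)]
      field_simp
    rw [← this, Complex.sq_norm, Complex.normSq_apply]; ring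
  have hinner : ∀ c : ℂ, ‖z‖ * (c.re * c.re + c.im * c.im) < 2 * R * (z * (starRingEnd ℂ) c).re →
      c.re * c.re + c.im * c.im < 2 * (y.re * c.re + y.im * c.im) := fun c hc => by
    have : 2 * R * (z * (starRingEnd ℂ) c).re = ‖z‖ * (2 * (y.re * c.re + y.im * c.im)) := by
      conv_lhs => rw [hzy]
      simp
      field_simp
    rw [this] at hc
    exact lt_of_mul_lt_mul_left hc hz.le
  have h2 := hinner a h2
  have h3 := hinner b h3
  simp only [Complex.sub_re, Complex.sub_im] at hab
  nlinarith [sq_nonneg (a.re + b.re - 3 * y.re), sq_nonneg (a.im + b.im - 3 * y.im)]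

lemma mul_volume_bisectorSector_ofReal_le {R a : ℝ} (hR : 0 < R) (ha : √3 * R ≤ a) :
    ENNReal.ofReal (3 * √3 / (2 * π)) * volume (bisectorSector R a) ≤
      volume (bisectorSector R a ∩ {z | ‖z‖ < ‖z - a‖}) := by
  have ha0 : 0 < a := lt_of_lt_of_le (by positivity) ha
  rcases le_or_gt (2 * R) a with h | h
  · rw [bisectorSector_eq_empty (by simpa [abs_of_pos ha0] using h)]
    simp
  obtain ⟨θ, hθ0, hθ6, hcos⟩ : ∃ θ, 0 ≤ θ ∧ θ ≤ π / 6 ∧ a = 2 * R * Real.cos θ := by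
    refine ⟨Real.arccos (a / (2 * R)), Real.arccos_nonneg _, ?_, ?_⟩
    · have h6 : Real.arccos (√3 / 2) = π / 6 := by
        rw [← Real.cos_pi_div_six, Real.arccos_cos (by positivity) (by linarith [Real.pi_pos])]
      rw [← h6]
      apply Real.arccos_le_arccos
      rw [le_div_iff₀ (by positivity)]
      linarith
    · have h1 : a / (2 * R) ≤ 1 := by rw [div_le_one (by positivity)]; exact h.le
      have h2 : 0 ≤ a / (2 * R) := by positivity
      rw [Real.cos_arccos (by linarith) h1]
      field_simp
  have hpi := Real.pi_pos
  have hc : 0 < Real.cos θ := Real.cos_pos_of_mem_Ioo ⟨by linarith, by linarith⟩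
  have hs : 0 ≤ Real.sin θ := Real.sin_nonneg_of_nonneg_of_le_pi hθ0 (by linarith)
  have hsec : bisectorSector R a = {z : ℂ | ‖z‖ < R ∧ ‖z‖ * Real.cos θ < z.re} := by
    ext z
    simp only [bisectorSector, mem_ofPred_eq, Complex.norm_real, Real.norm_of_nonneg ha0.le,
      Complex.conj_ofReal, Complex.re_mul_ofReal]
    refine and_congr_right fun _ => ?_
    have : ‖z‖ * a ^ 2 = 2 * R * a * (‖z‖ * Real.cos θ) := by
      rw [pow_two]; nth_rw 1 [hcos]; ring
    rw [this, mul_comm z.re, ← mul_assoc (2 * R) a, mul_lt_mul_iff_right₀ (by positivity)]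
  calc ENNReal.ofReal (3 * √3 / (2 * π)) * volume (bisectorSector R a)
      ≤ ENNReal.ofReal (3 * √3 / (2 * π)) * ENNReal.ofReal (R ^ 2 * θ) := by
        rw [hsec]
        gcongr
        exact volume_circular_sector_le hR.le hθ0
    _ = ENNReal.ofReal (R ^ 2 * (3 * √3 / (2 * π) * θ)) := by
        rw [← ENNReal.ofReal_mul (by positivity)]
        congr 1; ring
    _ ≤ ENNReal.ofReal (Real.sin θ / Real.cos θ * (R * Real.cos θ) ^ 2) := by
        have : Real.sin θ / Real.cos θ * (R * Real.cos θ) ^ 2 =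
          R ^ 2 * (Real.sin θ * Real.cos θ) := by field_simp
        rw [this]
        exact ENNReal.ofReal_le_ofReal
          (mul_le_mul_of_nonneg_left (mul_le_sin_mul_cos hθ0 hθ6) (sq_nonneg R))
    _ = volume {z : ℂ | 0 < z.re ∧ z.re < R * Real.cos θ ∧
          |z.im| < Real.sin θ / Real.cos θ * z.re} :=
        (volume_triangle _ _ (by positivity) (by positivity)).symm
    _ ≤ _ := by
        refine measure_mono fun z ⟨h1, h2, h3⟩ => ?_
        have h4 : ‖z‖ * Real.cos θ < z.re := by
          rw [div_mul_eq_mul_div, lt_div_iff₀ hc] at h3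
          refine lt_of_pow_lt_pow_left₀ 2 h1.le ?_
          have h5 := pow_lt_pow_left₀ h3 (by positivity) two_ne_zero
          rw [mul_pow, sq_abs] at h5
          rw [mul_pow, Complex.sq_norm, Complex.normSq_apply]
          nlinarith [Real.sin_sq_add_cos_sq θ]
        refine ⟨hsec ▸ ⟨lt_of_mul_lt_mul_right (h4.trans h2) hc.le, h4⟩, ?_⟩
        change ‖z‖ < ‖z - a‖
        rw [norm_lt_norm_sub_iff, Complex.conj_ofReal, Complex.re_mul_ofReal, Complex.norm_real,
          Real.norm_of_nonneg ha0.le]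
        nlinarith

lemma mul_volume_bisectorSector_le {R : ℝ} {q : ℂ} (hR : 0 < R) (hq : √3 * R ≤ ‖q‖) :
    ENNReal.ofReal (3 * √3 / (2 * π)) * volume (bisectorSector R q) ≤
      volume (bisectorSector R q ∩ {z | ‖z‖ < ‖z - q‖}) := by
  have hq0 : q ≠ 0 := by
    rw [← norm_pos_iff]
    exact lt_of_lt_of_le (by positivity) hq
  have hu : ‖q / ‖q‖‖ = 1 := by
    rw [norm_div, Complex.norm_real, norm_norm, div_self (norm_ne_zero_iff.2 hq0)]
  obtain ⟨u, huq⟩ : ∃ u : Circle, q = u * (‖q‖ : ℂ) := by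
    have : (‖q‖ : ℂ) ≠ 0 := by simpa using hq0
    exact ⟨⟨q / ‖q‖, mem_sphere_zero_iff_norm.2 hu⟩, (div_mul_cancel₀ q this).symm⟩
  have hmp := (rotation u).measurePreserving
  have hsec : rotation u ⁻¹' bisectorSector R q = bisectorSector R (‖q‖ : ℂ) := by
    ext z
    have : u * z * (starRingEnd ℂ) q = z * (starRingEnd ℂ) (‖q‖ : ℂ) := by
      conv_lhs => rw [huq]
      rw [map_mul]
      have : (u : ℂ) * (starRingEnd ℂ) (u : ℂ) = 1 := by
        rw [Complex.mul_conj, Complex.normSq_eq_norm_sq, Circle.norm_coe]; simp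
      linear_combination z * (starRingEnd ℂ) (‖q‖ : ℂ) * this
    simp only [bisectorSector, mem_preimage, mem_ofPred_eq, rotation_apply, this, norm_mul,
      Circle.norm_coe, one_mul, Complex.norm_real, norm_norm]
  have hhalf : rotation u ⁻¹' {z | ‖z‖ < ‖z - q‖} = {z | ‖z‖ < ‖z - (‖q‖ : ℂ)‖} := by
    ext z
    have : ‖u * z - q‖ = ‖z - (‖q‖ : ℂ)‖ := by
      conv_lhs => rw [huq]
      rw [← mul_sub, norm_mul, Circle.norm_coe, one_mul]
    simp only [mem_preimage, mem_ofPred_eq, rotation_apply, this, norm_mul, Circle.norm_coe,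
      one_mul]
  have hopen : IsOpen {z : ℂ | ‖z‖ < ‖z - q‖} := isOpen_lt (by fun_prop) (by fun_prop)
  rw [← hmp.measure_preimage (isOpen_bisectorSector R q).measurableSet.nullMeasurableSet,
    ← hmp.measure_preimage
      ((isOpen_bisectorSector R q).inter hopen).measurableSet.nullMeasurableSet,
    preimage_inter, hsec, hhalf]
  exact mul_volume_bisectorSector_ofReal_le hR hq

/-- The part of the open Voronoi cell of `0` with respect to the points `Q k` within
distance `R` of `0`. -/
def truncatedCell {ι : Type*} (R : ℝ) (Q : ι → ℂ) : Set ℂ :=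
  {z | ‖z‖ < R ∧ ∀ k, ‖z‖ < ‖z - Q k‖}

lemma measurableSet_truncatedCell {ι : Type*} [Countable ι] (R : ℝ) (Q : ι → ℂ) :
    MeasurableSet (truncatedCell R Q) := by
  have : truncatedCell R Q = {z | ‖z‖ < R} ∩ ⋂ k, {z | ‖z‖ < ‖z - Q k‖} := by
    ext z; simp [truncatedCell]
  rw [this]
  exact (isOpen_lt (by fun_prop) (by fun_prop)).measurableSet.inter
    (.iInter fun k => (isOpen_lt (by fun_prop) (by fun_prop)).measurableSet)

lemma norm_lt_norm_sub_of_notMem_bisectorSector {R : ℝ} {q z : ℂ} (hq : q ≠ 0) (hz : ‖z‖ < R)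
    (h : z ∉ bisectorSector R q) : ‖z‖ < ‖z - q‖ := by
  have hR : 0 < R := (norm_nonneg z).trans_lt hz
  have h1 : 2 * R * (z * (starRingEnd ℂ) q).re ≤ ‖z‖ * ‖q‖ ^ 2 := by
    by_contra! h'
    exact h ⟨hz, h'⟩
  rw [norm_lt_norm_sub_iff]
  have h2 : ‖z‖ * ‖q‖ ^ 2 < R * ‖q‖ ^ 2 := by
    have := norm_pos_iff.2 hq
    gcongr
  exact lt_of_mul_lt_mul_left (by linarith) hR.le

theorem le_volume_truncatedCell {ι : Type*} [Countable ι] {R : ℝ} (hR : 0 < R) {Q : ι → ℂ}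
    (hQ : ∀ k, √3 * R ≤ ‖Q k‖) (hQQ : ∀ k l, k ≠ l → √3 * R ≤ ‖Q k - Q l‖) :
    ENNReal.ofReal (3 * √3 / 2 * R ^ 2) ≤ volume (truncatedCell R Q) := by
  set c := ENNReal.ofReal (3 * √3 / (2 * π)) with hc
  set S := fun k => bisectorSector R (Q k) with hS
  have hSm : ∀ k, MeasurableSet (S k) := fun k => (isOpen_bisectorSector R (Q k)).measurableSet
  have hSd : Pairwise (Function.onFun Disjoint S) := fun k l hkl =>
    disjoint_bisectorSector (hQ k) (hQ l) (hQQ k l hkl)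
  have hQ0 : ∀ k, Q k ≠ 0 := fun k =>
    norm_pos_iff.1 (lt_of_lt_of_le (by positivity) (hQ k))
  have hU : MeasurableSet (⋃ k, S k) := .iUnion hSm
  have hc1 : c ≤ 1 := by
    rw [hc, ENNReal.ofReal_le_one, div_le_one (by positivity)]
    have h3 : √3 ≤ 2 := Real.sqrt_le_iff.2 ⟨by norm_num, by norm_num⟩
    linarith [Real.pi_gt_three]
  have hin : c * volume (⋃ k, S k) ≤ volume (truncatedCell R Q ∩ ⋃ k, S k) := by
    rw [inter_iUnion, measure_iUnion hSd hSm, measure_iUnion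
      (fun k l hkl => (hSd hkl).mono inter_subset_right inter_subset_right)
      (fun k => (measurableSet_truncatedCell R Q).inter (hSm k)), ← ENNReal.tsum_mul_left]
    refine ENNReal.tsum_le_tsum fun k => (mul_volume_bisectorSector_le hR (hQ k)).trans ?_
    refine measure_mono fun z ⟨hz, hzk⟩ => ⟨⟨hz.1, fun l => ?_⟩, hz⟩
    by_cases hkl : k = l
    · exact hkl ▸ hzk
    · exact norm_lt_norm_sub_of_notMem_bisectorSector (hQ0 l) hz.1
        (disjoint_left.1 (hSd hkl) hz)
  have hout : c * volume (Metric.ball 0 R \ ⋃ k, S k) ≤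
      volume (truncatedCell R Q \ ⋃ k, S k) := by
    refine (mul_le_of_le_one_left' hc1).trans (measure_mono fun z ⟨hz, hzS⟩ => ⟨?_, hzS⟩)
    have hz : ‖z‖ < R := by simpa using hz
    exact ⟨hz, fun k => norm_lt_norm_sub_of_notMem_bisectorSector (hQ0 k) hz
      fun h => hzS (mem_iUnion_of_mem k h)⟩
  have hsub : ⋃ k, S k ⊆ Metric.ball 0 R := iUnion_subset fun k z hz => by simpa using hz.1
  calc ENNReal.ofReal (3 * √3 / 2 * R ^ 2) = c * volume (Metric.ball (0 : ℂ) R) := by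
        rw [Complex.volume_ball, hc, ← ENNReal.ofReal_coe_nnreal, NNReal.coe_real_pi,
          ← ENNReal.ofReal_pow hR.le, ← ENNReal.ofReal_mul (by positivity),
          ← ENNReal.ofReal_mul (by positivity)]
        congr 1
        field_simp
    _ = c * volume (⋃ k, S k) + c * volume (Metric.ball 0 R \ ⋃ k, S k) := by
        rw [← measure_inter_add_sdiff _ hU, inter_eq_self_of_subset_right hsub, mul_add]
    _ ≤ _ := by
        rw [← measure_inter_add_sdiff (truncatedCell R Q) hU]
        exact add_le_add hin hout

/-- Thue's inequality for periodic configurations: the union of the translates of `card ι` points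
by a lattice of covolume `volume F` can only be `d`-separated if
`card ι * (√3 / 2 * d ^ 2) ≤ volume F`. -/
theorem card_mul_le_volume_fundamentalDomain {ι : Type*} [Fintype ι] {L : AddSubgroup ℂ}
    [Countable L] {F : Set ℂ} (fund : IsAddFundamentalDomain L F) {P : ι → ℂ} {d : ℝ} (hd : 0 < d)
    (hP : ∀ i j, ∀ l ∈ L, (i ≠ j ∨ l ≠ 0) → d ≤ ‖P i - P j + l‖) :
    Fintype.card ι * ENNReal.ofReal (√3 / 2 * d ^ 2) ≤ volume F := by
  set R := d / √3 with hRdef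
  have hR : 0 < R := by positivity
  have hdR : √3 * R = d := by rw [hRdef]; field_simp
  let Q : ∀ i : ι, {k : ι × L // k ≠ (i, 0)} → ℂ := fun i k => P k.1.1 + k.1.2 - P i
  set C : ι → Set ℂ := fun i => (fun z => z - P i) ⁻¹' truncatedCell R (Q i) with hC
  have hCm : ∀ i, MeasurableSet (C i) := fun i =>
    (measurableSet_truncatedCell R (Q i)).preimage (by fun_prop)
  have hlt : ∀ {i j : ι} {l : ℂ} {z : ℂ}, l ∈ L → (i ≠ j ∨ l ≠ 0) → z ∈ C i →
      ‖z - P i‖ < ‖z - l - P j‖ := by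
    intro i j l z hl hne hz
    have := hz.2 ⟨(j, ⟨l, hl⟩), by
      rintro h
      simp only [Prod.mk.injEq, AddSubgroup.mk_eq_zero] at h
      rcases hne with h' | h'
      · exact h' h.1.symm
      · exact h' h.2⟩
    convert this using 2
    simp only [Q]
    ring
  have hCd : Pairwise (Function.onFun Disjoint C) := fun i j hij =>
    disjoint_left.2 fun z hzi hzj => by
      have h1 := hlt L.zero_mem (.inl hij) hzi
      have h2 := hlt L.zero_mem (.inl hij.symm) hzj
      rw [sub_zero] at h1 h2
      exact lt_asymm h1 h2
  have hvol : ∀ i, ENNReal.ofReal (√3 / 2 * d ^ 2) ≤ volume (C i) := fun i => by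
    have h3 : √3 / 2 * d ^ 2 = 3 * √3 / 2 * R ^ 2 := by
      rw [← hdR, mul_pow, Real.sq_sqrt (by norm_num)]; ring
    rw [h3, show volume (C i) = volume (truncatedCell R (Q i)) by
      simp only [hC, sub_eq_add_neg, measure_preimage_add_right]]
    refine le_volume_truncatedCell hR (fun ⟨k, hk⟩ => ?_) fun ⟨k, hk⟩ ⟨m, hm⟩ hkm => ?_
    · rw [hdR]
      convert hP k.1 i k.2 k.2.2 ?_ using 2
      · simp only [Q]; ring
      · by_contra! h
        exact hk (Prod.ext h.1 (Subtype.ext h.2))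
    · rw [hdR]
      convert hP k.1 m.1 (k.2 - m.2 : L) (k.2 - m.2).2 ?_ using 2
      · simp only [Q, AddSubgroup.coe_sub]; ring
      · by_contra! h
        refine hkm (Subtype.ext (Prod.ext h.1 ?_))
        rw [← sub_eq_zero]
        exact Subtype.ext h.2
  have hunion : Fintype.card ι * ENNReal.ofReal (√3 / 2 * d ^ 2) ≤ volume (⋃ i, C i) := by
    rw [measure_iUnion hCd hCm, tsum_fintype, ← nsmul_eq_mul]
    exact Finset.card_nsmul_le_sum _ _ _ fun i _ => hvol i
  refine hunion.trans ?_
  by_contra! h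
  obtain ⟨l, m, hlm, hnd⟩ := exists_pair_mem_lattice_not_disjoint_vadd fund
    (MeasurableSet.iUnion hCm).nullMeasurableSet h
  obtain ⟨_, ⟨x, hx, rfl⟩, y, hy, hxy⟩ := not_disjoint_iff.1 hnd
  obtain ⟨i, hi⟩ := mem_iUnion.1 hx
  obtain ⟨j, hj⟩ := mem_iUnion.1 hy
  have hxy : (m : ℂ) + y = l + x := hxy
  have hlm' : (l : ℂ) ≠ m := fun h => hlm (Subtype.ext h)
  have h1 := hlt (L.sub_mem m.2 l.2) (.inr (sub_ne_zero.2 hlm'.symm)) hi (j := j)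
  have h2 := hlt (L.sub_mem l.2 m.2) (.inr (sub_ne_zero.2 hlm')) hj (j := i)
  rw [show x - ((m : ℂ) - l) = y by linear_combination -hxy] at h1
  rw [show y - ((l : ℂ) - m) = x by linear_combination hxy] at h2
  exact lt_asymm h1 h2

lemma volume_fundamentalDomain_orthonormalBasisOneI :
    volume (ZSpan.fundamentalDomain Complex.orthonormalBasisOneI.toBasis) = 1 := by
  rw [measure_congr (ZSpan.fundamentalDomain_ae_parallelepiped _ volume)]
  simpa using Complex.orthonormalBasisOneI.volume_parallelepiped

lemma exists_int_of_mem_span_orthonormalBasisOneI {l : ℂ}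
    (hl : l ∈ (Submodule.span ℤ (range Complex.orthonormalBasisOneI.toBasis)).toAddSubgroup) :
    ∃ m n : ℤ, l = ⟨m, n⟩ := by
  have h := (Complex.orthonormalBasisOneI.toBasis.mem_span_iff_repr_mem ℤ l).1 hl
  obtain ⟨m, hm⟩ := h 0
  obtain ⟨n, hn⟩ := h 1
  refine ⟨m, n, Complex.ext ?_ ?_⟩
  · simpa using hm.symm
  · simpa using hn.symm

lemma e2norm_le_e2norm_of_round (v : ℝ × ℝ) (m n : ℤ) :
    e2norm (v + (((-round v.1 : ℤ) : ℝ), ((-round v.2 : ℤ) : ℝ))) ≤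
      e2norm (v + ((m : ℝ), (n : ℝ))) := by
  have key : ∀ (x : ℝ) (k : ℤ), (x + ((-round x : ℤ) : ℝ)) ^ 2 ≤ (x + k) ^ 2 := fun x k => by
    have := round_le x (-k)
    rw [← sq_le_sq] at this
    push_cast at this ⊢
    simpa [sub_eq_add_neg] using this
  exact Real.sqrt_le_sqrt (add_le_add (key v.1 m) (key v.2 n))

lemma norm_eq_e2norm (z : ℂ) : ‖z‖ = e2norm (z.re, z.im) := by
  rw [Complex.norm_eq_sqrt_sq_add_sq, e2norm]

/-- For every configuration of `N ≥ 2` points on the square flat torus, the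
minimal toroidal distance is at most `2 / √(N·√12)`. -/
theorem min_dist_le_density_bound (N : ℕ) (hN : 2 ≤ N) (p : Fin N → ℝ × ℝ) :
    ∃ i j : Fin N, i ≠ j ∧ ∃ m n : ℤ,
      e2norm (p i - p j + ((m : ℝ), (n : ℝ))) ≤
        2 / Real.sqrt ((N : ℝ) * Real.sqrt 12) := by
  by_contra! hsep
  set D := 2 / √((N : ℝ) * √12) with hD
  have hN2 : (2 : ℝ) ≤ N := by exact_mod_cast hN
  have h12 : √12 = 2 * √3 := by
    rw [show (12 : ℝ) = 2 ^ 2 * 3 by norm_num, Real.sqrt_mul (by positivity),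
      Real.sqrt_sq (by norm_num)]
  have hD0 : 0 < D := by positivity
  have hDN : N * (√3 / 2 * D ^ 2) = 1 := by
    rw [hD, div_pow, Real.sq_sqrt (by positivity), h12]
    field_simp
  have hD1 : D < 1 := by
    have h3 : (1 : ℝ) < √3 := Real.lt_sqrt_of_sq_lt (by norm_num)
    have h4 : 1 < N * (√3 / 2) := by nlinarith
    by_contra! h
    nlinarith [one_le_pow₀ h (n := 2)]
  let δ : Fin N → Fin N → ℝ := fun i j => e2norm (p i - p j +
    (((-round (p i - p j).1 : ℤ) : ℝ), ((-round (p i - p j).2 : ℤ) : ℝ)))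
  obtain ⟨d, ⟨hd1, hdδ⟩, hDd⟩ :
      ∃ d, (d ≤ 1 ∧ ∀ i j, i ≠ j → d ≤ δ i j) ∧ D < d := by
    have h1 : ∀ᶠ d in nhdsWithin D (Ioi D), d ≤ 1 ∧ ∀ i j, i ≠ j → d ≤ δ i j := by
      refine Filter.Eventually.filter_mono nhdsWithin_le_nhds ?_
      refine (eventually_le_nhds hD1).and (Filter.eventually_all.2 fun i =>
        Filter.eventually_all.2 fun j => ?_)
      by_cases hij : i = j
      · simp [hij]
      · simpa [hij] using eventually_le_nhds (hsep i j hij _ _)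
    exact (h1.and self_mem_nhdsWithin).exists
  have : Countable
      (Submodule.span ℤ (range Complex.orthonormalBasisOneI.toBasis)).toAddSubgroup :=
    inferInstanceAs (Countable (Submodule.span ℤ (range Complex.orthonormalBasisOneI.toBasis)))
  have hmain := card_mul_le_volume_fundamentalDomain (P := fun i => (⟨(p i).1, (p i).2⟩ : ℂ))
    (ZSpan.isAddFundamentalDomain' Complex.orthonormalBasisOneI.toBasis volume)
    (hD0.trans hDd) (fun i j l hl hne => by
      obtain ⟨m, n, rfl⟩ := exists_int_of_mem_span_orthonormalBasisOneI hl
      by_cases hij : i = j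
      · subst hij
        refine hd1.trans ?_
        rw [sub_self, zero_add, norm_eq_e2norm, e2norm, Real.one_le_sqrt]
        have hmn : m ≠ 0 ∨ n ≠ 0 := by
          by_contra! h
          rcases hne with h' | h'
          · exact h' rfl
          · exact h' (by simp [h.1, h.2, Complex.ext_iff])
        have : (1 : ℤ) ≤ m ^ 2 + n ^ 2 := by
          rcases hmn with h | h
          · nlinarith [Int.one_le_abs h, sq_abs m, sq_nonneg n]
          · nlinarith [Int.one_le_abs h, sq_abs n, sq_nonneg m]
        change (1 : ℝ) ≤ (m : ℝ) ^ 2 + (n : ℝ) ^ 2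
        exact_mod_cast this
      · rw [norm_eq_e2norm]
        exact (hdδ i j hij).trans (e2norm_le_e2norm_of_round _ m n))
  rw [volume_fundamentalDomain_orthonormalBasisOneI, Fintype.card_fin, ← ENNReal.ofReal_natCast,
    ← ENNReal.ofReal_mul (by positivity), ENNReal.ofReal_le_one, ← hDN] at hmain
  have : N * (√3 / 2 * D ^ 2) < N * (√3 / 2 * d ^ 2) := by gcongr
  exact this.not_ge hmain
end
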